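/- Let d ≥ 3 and let f_d ∈ ℂ[x,y,z] be a homogeneous polynomial of degree d which is irreducible and convenient (the coefficients of x^d, y^d, z^d in f_d are all nonzero), such that the projective plane curve C = {f_d = 0} ⊂ ℙ² has exactly k singular points, with k ≤ (d−1)(d−2)/2, each of which is an ordinary node (at each singular point, in an affine coordinate chart containing it, the dehomogenized polynomial has vanishing gradient and invertible 2×2 Hessian at that point), and assume all singular points of C lie in the affine chart {x ≠ 0}. Then f = f_d + x^{d+1} has an isolated critical point at the origin of ℂ³ and its Milnor number is μ(f) = (d−1)³ + k. -/

import Mathlib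

open MvPolynomial

/-- The Milnor number of a polynomial `F ∈ ℂ[x,y,z]`: the `ℂ`-dimension of the quotient of the
formal power series ring `ℂ⟦x,y,z⟧` by the ideal generated by the three partial derivatives. -/
noncomputable def milnorNumber (F : MvPolynomial (Fin 3) ℂ) : ℕ :=
  Module.finrank ℂ (MvPowerSeries (Fin 3) ℂ ⧸
    Ideal.span (Set.range fun i : Fin 3 => (pderiv i F).toMvPowerSeries))

/-- `F` has a critical point at the origin of `ℂ³`, and it is isolated. -/
def HasIsolatedCriticalPointAtOrigin (F : MvPolynomial (Fin 3) ℂ) : Prop :=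
  (∀ i, eval (0 : Fin 3 → ℂ) (pderiv i F) = 0) ∧
  ∃ ε > (0 : ℝ), ∀ p : Fin 3 → ℂ, ‖p‖ < ε → (∀ i, eval p (pderiv i F) = 0) → p = 0

/-- The dehomogenization `F(1, u₀, u₁)` of `F ∈ ℂ[x₀,x₁,x₂]` in the affine chart `{x₀ ≠ 0}`. -/
noncomputable def dehom0 (F : MvPolynomial (Fin 3) ℂ) : MvPolynomial (Fin 2) ℂ :=
  aeval ![1, X 0, X 1] F

namespace NodalMilnor

local notation "R₃" => MvPolynomial (Fin 3) ℂ

theorem finrank_homogeneousSubmodule (n : ℕ) :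
    Module.finrank ℂ (homogeneousSubmodule (Fin 3) ℂ n) = (n + 2).choose 2 := by
  have h : {d : Fin 3 →₀ ℕ | d.degree = n} =
      ↑(Finset.finsuppAntidiag (Finset.univ : Finset (Fin 3)) n) := by
    ext d
    simp [Finsupp.degree_eq_sum]
  rw [homogeneousSubmodule_eq_finsupp_supported, h,
    (AddMonoidAlgebra.supportedEquivFinsupp (R := ℂ) (S := ℂ) _).finrank_eq,
    Module.finrank_finsupp_self]
  simp only [Finset.coe_sort_coe, Fintype.card_coe]
  rw [Finset.card_finsuppAntidiag_nat_eq_choose, Finset.card_univ, Fintype.card_fin,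
    show 3 + n - 1 = n + 2 by omega, Nat.choose_symm_add]

theorem homogeneousComponent_mul_of_isHomogeneous {P : R₃} {m : ℕ} (hP : P.IsHomogeneous m)
    (a : R₃) (n : ℕ) :
    homogeneousComponent (n + m) (a * P) = homogeneousComponent n a * P := by
  conv_lhs => rw [← sum_homogeneousComponent a, Finset.sum_mul, map_sum]
  have h (i : ℕ) : homogeneousComponent (n + m) (homogeneousComponent i a * P) =
      if i = n then homogeneousComponent n a * P else 0 := by
    rw [homogeneousComponent_of_mem
      ((homogeneousComponent_isHomogeneous i a).mul hP : _ ∈ homogeneousSubmodule _ _ _)]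
    split_ifs <;> first | rfl | (exfalso; omega) | (subst_vars; simp_all)
  simp only [h, Finset.sum_ite_eq', Finset.mem_range]
  split_ifs with h1
  · rfl
  · rw [homogeneousComponent_eq_zero _ _ (by omega), zero_mul]

theorem homogeneousComponent_mul_of_lt {P : R₃} {m : ℕ} (hP : P.IsHomogeneous m)
    (a : R₃) {n : ℕ} (hn : n < m) : homogeneousComponent n (a * P) = 0 := by
  conv_lhs => rw [← sum_homogeneousComponent a, Finset.sum_mul, map_sum]
  refine Finset.sum_eq_zero fun i _ => ?_
  rw [homogeneousComponent_of_mem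
      ((homogeneousComponent_isHomogeneous i a).mul hP : _ ∈ homogeneousSubmodule _ _ _),
    if_neg (by omega)]

theorem exists_homogeneous_of_mem_span_pair {P Q F : R₃} {m n : ℕ} (hP : P.IsHomogeneous m)
    (hQ : Q.IsHomogeneous m) (hF : F.IsHomogeneous (n + m)) (h : F ∈ Ideal.span {P, Q}) :
    ∃ a b : R₃, a.IsHomogeneous n ∧ b.IsHomogeneous n ∧ a * P + b * Q = F := by
  obtain ⟨a, b, hab⟩ := Ideal.mem_span_pair.1 h
  refine ⟨homogeneousComponent n a, homogeneousComponent n b,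
    homogeneousComponent_isHomogeneous _ _, homogeneousComponent_isHomogeneous _ _, ?_⟩
  rw [← homogeneousComponent_mul_of_isHomogeneous hP,
    ← homogeneousComponent_mul_of_isHomogeneous hQ,
    ← map_add, hab, homogeneousComponent_eq_self hF]

theorem eq_zero_of_mem_span_pair_of_lt {P Q F : R₃} {m n : ℕ} (hP : P.IsHomogeneous m)
    (hQ : Q.IsHomogeneous m) (hF : F.IsHomogeneous n) (hn : n < m) (h : F ∈ Ideal.span {P, Q}) :
    F = 0 := by
  obtain ⟨a, b, hab⟩ := Ideal.mem_span_pair.1 h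
  rw [← homogeneousComponent_eq_self hF, ← hab, map_add, homogeneousComponent_mul_of_lt hP a hn,
    homogeneousComponent_mul_of_lt hQ b hn, add_zero]

theorem isHomogeneous_of_mul {P a : R₃} {m n : ℕ} (hP : P.IsHomogeneous m) (hP0 : P ≠ 0)
    (h : (a * P).IsHomogeneous (n + m)) : a.IsHomogeneous n := by
  have := homogeneousComponent_mul_of_isHomogeneous hP a n
  rw [homogeneousComponent_eq_self h] at this
  rw [mul_right_cancel₀ hP0 this]
  exact homogeneousComponent_isHomogeneous _ _

theorem map_mulRight_inf {P Q : R₃} {m j : ℕ} (hP : P.IsHomogeneous m) (hQ : Q.IsHomogeneous m)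
    (hQ0 : Q ≠ 0) (hPQ : IsRelPrime P Q) :
    (homogeneousSubmodule (Fin 3) ℂ (m + j)).map (LinearMap.mulRight ℂ P) ⊓
      (homogeneousSubmodule (Fin 3) ℂ (m + j)).map (LinearMap.mulRight ℂ Q) =
    (homogeneousSubmodule (Fin 3) ℂ j).map (LinearMap.mulRight ℂ (P * Q)) := by
  ext F
  simp only [Submodule.mem_inf, Submodule.mem_map, mem_homogeneousSubmodule,
    LinearMap.mulRight_apply]
  constructor
  · rintro ⟨⟨a, ha, rfl⟩, b, hb, hab⟩
    obtain ⟨c, rfl⟩ : Q ∣ a := hPQ.symm.dvd_of_dvd_mul_right ⟨b, by rw [← hab]; ring⟩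
    refine ⟨c, isHomogeneous_of_mul hQ hQ0 (by rwa [mul_comm, add_comm]), by ring⟩
  · rintro ⟨c, hc, rfl⟩
    exact ⟨⟨c * Q, by rw [add_comm]; exact hc.mul hQ, by ring⟩,
      c * P, by rw [add_comm]; exact hc.mul hP, by ring⟩

theorem map_mulRight_sup {P Q : R₃} {m j : ℕ} (hP : P.IsHomogeneous m) (hQ : Q.IsHomogeneous m) :
    (homogeneousSubmodule (Fin 3) ℂ (m + j)).map (LinearMap.mulRight ℂ P) ⊔
      (homogeneousSubmodule (Fin 3) ℂ (m + j)).map (LinearMap.mulRight ℂ Q) =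
    homogeneousSubmodule (Fin 3) ℂ (m + j + m) ⊓
      (Ideal.span {P, Q}).restrictScalars ℂ := by
  ext F
  simp only [Submodule.mem_inf, Submodule.mem_sup, Submodule.mem_map, mem_homogeneousSubmodule,
    LinearMap.mulRight_apply, Submodule.restrictScalars_mem]
  constructor
  · rintro ⟨_, ⟨a, ha, rfl⟩, _, ⟨b, hb, rfl⟩, rfl⟩
    exact ⟨(ha.mul hP).add (hb.mul hQ), Ideal.mem_span_pair.2 ⟨a, b, rfl⟩⟩
  · rintro ⟨hF, h⟩
    obtain ⟨a, b, ha, hb, rfl⟩ := exists_homogeneous_of_mem_span_pair hP hQ hF h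
    exact ⟨_, ⟨a, ha, rfl⟩, _, ⟨b, hb, rfl⟩, rfl⟩

instance finite_homogeneousSubmodule (n : ℕ) :
    Module.Finite ℂ (homogeneousSubmodule (Fin 3) ℂ n) :=
  Module.Finite.iff_fg.2 (homogeneousSubmodule_fg _ _ n)

theorem finrank_map_mulRight {P : R₃} (hP0 : P ≠ 0) (n : ℕ) :
    Module.finrank ℂ ((homogeneousSubmodule (Fin 3) ℂ n).map (LinearMap.mulRight ℂ P)) =
      (n + 2).choose 2 := by
  rw [← finrank_homogeneousSubmodule]
  exact (LinearEquiv.finrank_eq (Submodule.equivMapOfInjective (LinearMap.mulRight ℂ P)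
    (fun a b h => mul_right_cancel₀ hP0 h) _)).symm

theorem finrank_homogeneousSubmodule_inf_span {P Q : R₃} {m j : ℕ} (hP : P.IsHomogeneous m)
    (hQ : Q.IsHomogeneous m) (hP0 : P ≠ 0) (hQ0 : Q ≠ 0) (hPQ : IsRelPrime P Q) :
    Module.finrank ℂ ↥(homogeneousSubmodule (Fin 3) ℂ (m + j + m) ⊓
      (Ideal.span {P, Q}).restrictScalars ℂ) + m ^ 2 = (m + j + m + 2).choose 2 := by
  have h := Submodule.finrank_sup_add_finrank_inf_eq
    ((homogeneousSubmodule (Fin 3) ℂ (m + j)).map (LinearMap.mulRight ℂ P))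
    ((homogeneousSubmodule (Fin 3) ℂ (m + j)).map (LinearMap.mulRight ℂ Q))
  rw [map_mulRight_inf hP hQ hQ0 hPQ, map_mulRight_sup hP hQ, finrank_map_mulRight hP0,
    finrank_map_mulRight hQ0, finrank_map_mulRight (mul_ne_zero hP0 hQ0)] at h
  have key : (m + j + m + 2).choose 2 + (j + 2).choose 2 =
      (m + j + 2).choose 2 + (m + j + 2).choose 2 + m ^ 2 := by
    have := Nat.cast_choose_two ℚ
    have : (((m + j + m + 2).choose 2 + (j + 2).choose 2 : ℕ) : ℚ) =
      ((m + j + 2).choose 2 + (m + j + 2).choose 2 + m ^ 2 : ℕ) := by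
      push_cast [this]
      ring
    exact_mod_cast this
  omega

theorem sub_C_mul_X_pow_mem {P : R₃} {m : ℕ} (hP : P.IsHomogeneous m) :
    P - C (coeff (Finsupp.single 1 m) P) * X 1 ^ m ∈ Ideal.span (X '' {0, 2} : Set R₃) := by
  rw [mem_ideal_span_X_image]
  intro e he
  by_contra hc
  simp only [Set.mem_insert_iff, Set.mem_singleton_iff, exists_eq_or_imp, exists_eq_left,
    not_or, not_not] at hc
  rw [mem_support_iff, coeff_sub, coeff_C_mul, coeff_X_pow] at he
  by_cases hd : e.degree = m
  · have : e = Finsupp.single 1 m := by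
      rw [Finsupp.degree_eq_sum, Fin.sum_univ_three, hc.1, hc.2] at hd
      ext i
      fin_cases i
      · simp [hc.1]
      · simp only [Fin.mk_one, Finsupp.single_eq_same]
        omega
      · simp [hc.2]
    subst this
    simp at he
  · have h1 : Finsupp.single 1 m ≠ e := by
      rintro rfl
      simp at hd
    rw [if_neg h1, hP.coeff_eq_zero hd] at he
    simp at he

theorem mem_span_X_of_mul_mem {P c : R₃} {m : ℕ} (hP : P.IsHomogeneous m)
    (hy : coeff (Finsupp.single 1 m) P ≠ 0) (h : c * P ∈ Ideal.span (X '' {0, 2} : Set R₃)) :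
    c ∈ Ideal.span (X '' {0, 2} : Set R₃) := by
  have h1 : c * monomial (Finsupp.single 1 m) (coeff (Finsupp.single 1 m) P) ∈
      Ideal.span (X '' {0, 2} : Set R₃) := by
    have := Ideal.sub_mem _ h (Ideal.mul_mem_left _ c (sub_C_mul_X_pow_mem hP))
    convert this using 1
    rw [← C_mul_X_pow_eq_monomial]
    ring
  rw [mem_ideal_span_X_image] at h1 ⊢
  intro e he
  obtain ⟨i, hi, h2⟩ := h1 (e + Finsupp.single 1 m) (by
    rw [mem_support_iff] at he ⊢
    rw [coeff_mul_monomial]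
    exact mul_ne_zero he hy)
  refine ⟨i, hi, ?_⟩
  rcases hi with rfl | rfl <;> simpa using h2

theorem mem_span_pair_of_X_mul_mem {P Q v : R₃} {m : ℕ} (hP : P.IsHomogeneous m)
    (hy : coeff (Finsupp.single 1 m) P ≠ 0) (hQ0 : Q ≠ 0) (hPQ : IsRelPrime P Q)
    (h0 : X 0 * v ∈ Ideal.span {P, Q}) (h2 : X 2 * v ∈ Ideal.span {P, Q}) :
    v ∈ Ideal.span {P, Q} := by
  have hX (i : Fin 3) : (X i : R₃) ≠ 0 := X_ne_zero i
  have hdvd {u : R₃} (h : X 0 ∣ X 2 * u) : X 0 ∣ u :=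
    ((X_prime (R := ℂ)).dvd_or_dvd h).resolve_left (by simp [X_dvd_X])
  obtain ⟨a, b, hab⟩ := Ideal.mem_span_pair.1 h0
  obtain ⟨a', b', hab'⟩ := Ideal.mem_span_pair.1 h2
  have hrel : (X 2 * a - X 0 * a') * P = -(X 2 * b - X 0 * b') * Q := by
    linear_combination X 2 * hab - X 0 * hab'
  obtain ⟨c, hc⟩ : Q ∣ X 2 * a - X 0 * a' :=
    hPQ.symm.dvd_of_dvd_mul_right ⟨_, by rw [hrel, mul_comm]⟩
  have hc' : X 2 * b - X 0 * b' = - (c * P) := by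
    apply mul_right_cancel₀ hQ0
    rw [hc] at hrel
    linear_combination hrel
  have hmem : c ∈ Ideal.span (X '' {0, 2} : Set R₃) := by
    refine mem_span_X_of_mul_mem hP hy ?_
    rw [← neg_neg (c * P), ← hc', Set.image_pair, neg_mem_iff]
    exact Ideal.mem_span_pair.2 ⟨-b', b, by ring⟩
  rw [Set.image_pair] at hmem
  obtain ⟨β, α, hβ⟩ := Ideal.mem_span_pair.1 hmem
  obtain ⟨a₁, ha₁⟩ : X 0 ∣ a - α * Q := hdvd ⟨a' + β * Q, by
    linear_combination hc - Q * hβ⟩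
  obtain ⟨b₁, hb₁⟩ : X 0 ∣ b + α * P := hdvd ⟨b' - β * P, by
    linear_combination hc' + P * hβ⟩
  refine Ideal.mem_span_pair.2 ⟨a₁, b₁, mul_left_cancel₀ (hX 0) ?_⟩
  linear_combination hab - P * ha₁ - Q * hb₁

theorem exists_linear_form_regular {P Q : R₃} {m : ℕ} (hP : P.IsHomogeneous m)
    (hy : coeff (Finsupp.single 1 m) P ≠ 0) (hQ0 : Q ≠ 0) (hPQ : IsRelPrime P Q) :
    ∃ l : ℂ, ∀ v : R₃, (X 0 + C l * X 2) * v ∈ Ideal.span {P, Q} → v ∈ Ideal.span {P, Q} := by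
  set I : Ideal R₃ := Ideal.span {P, Q}
  have hfin : (⋃ p ∈ associatedPrimes R₃ (R₃ ⧸ I),
      {l : ℂ | X 0 + C l * X 2 ∈ p}).Finite := by
    refine (associatedPrimes.finite R₃ (R₃ ⧸ I)).biUnion fun p hp => ?_
    refine Set.Subsingleton.finite fun l hl l' hl' => ?_
    by_contra hne
    rw [AssociatedPrimes.mem_iff, isAssociatedPrime_iff] at hp
    obtain ⟨hprime, w, hw⟩ := hp
    obtain ⟨v, rfl⟩ := Ideal.Quotient.mk_surjective w
    have hmem (u : R₃) : u ∈ p ↔ u * v ∈ I := by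
      rw [hw, Submodule.mem_colon_singleton, Submodule.mem_bot, ← Ideal.Quotient.eq_zero_iff_mem]
      rfl
    have h2 : X 2 ∈ p := by
      have := Ideal.mul_mem_left p (C (l - l')⁻¹) (p.sub_mem hl hl')
      convert this using 1
      have h3 : (C (l - l')⁻¹ : R₃) * C (l - l') = 1 := by
        rw [← C_mul, inv_mul_cancel₀ (sub_ne_zero.2 hne), C_1]
      rw [C_sub] at h3
      linear_combination - X 2 * h3
    have h0 : X 0 ∈ p := by
      have := p.sub_mem hl (Ideal.mul_mem_left p (C l) h2)
      rwa [add_sub_cancel_right] at this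
    refine hprime.ne_top ((Ideal.eq_top_iff_one p).2 ((hmem 1).2 ?_))
    rw [one_mul]
    exact mem_span_pair_of_X_mul_mem hP hy hQ0 hPQ ((hmem _).1 h0) ((hmem _).1 h2)
  obtain ⟨l, hl⟩ := hfin.exists_notMem
  refine ⟨l, fun v hv => ?_⟩
  by_contra hvI
  have : (X 0 + C l * X 2 : R₃) ∈ {r : R₃ | ∃ x : R₃ ⧸ I, x ≠ 0 ∧ r • x = 0} :=
    ⟨Ideal.Quotient.mk I v, mt Ideal.Quotient.eq_zero_iff_mem.1 hvI,
      Ideal.Quotient.eq_zero_iff_mem.2 hv⟩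
  rw [← biUnion_associatedPrimes_eq_zero_divisors] at this
  simp only [Set.mem_iUnion, SetLike.mem_coe, exists_prop] at this hl
  obtain ⟨p, hp, hp'⟩ := this
  exact hl ⟨p, hp, hp'⟩

theorem aeval_mul_of_isHomogeneous {S : Type*} [CommRing S] [Algebra ℂ S] {F : R₃} {n : ℕ}
    (hF : F.IsHomogeneous n) (g : Fin 3 → S) (t : S) :
    aeval (fun i => g i * t) F = aeval g F * t ^ n := by
  rw [aeval_def, aeval_def, eval₂_eq', eval₂_eq', Finset.sum_mul]
  refine Finset.sum_congr rfl fun e he => ?_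
  have hn : n = ∑ i, e i := by
    rw [hF.degree_eq_sum_deg_support he, ← Finsupp.degree_eq_sum, Finsupp.degree_apply]
  rw [hn, ← Finset.prod_pow_eq_pow_sum, mul_assoc, ← Finset.prod_mul_distrib]
  simp only [mul_pow]

/-- The ideal of the points of `P = Q = 0` in the affine chart `{L = 1}`. -/
noncomputable def chartIdeal (P Q L : R₃) : Ideal R₃ := Ideal.span {P, Q, L - 1}

section Chart

variable {P Q L : R₃} {m n : ℕ}

theorem mem_span_of_mem_chartIdeal (hP : P.IsHomogeneous m) (hQ : Q.IsHomogeneous m)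
    (hL : L.IsHomogeneous 1)
    (hreg : ∀ v : R₃, L * v ∈ Ideal.span {P, Q} → v ∈ Ideal.span {P, Q})
    {F : R₃} (hF : F.IsHomogeneous n) (h : F ∈ chartIdeal P Q L) : F ∈ Ideal.span {P, Q} := by
  set I : Ideal R₃ := Ideal.span {P, Q}
  set l : R₃ ⧸ I := Ideal.Quotient.mk I L
  have hl : l ∈ nonZeroDivisors (R₃ ⧸ I) := by
    rw [mem_nonZeroDivisors_iff_right]
    intro w hw
    obtain ⟨v, rfl⟩ := Ideal.Quotient.mk_surjective w
    rw [mul_comm, ← map_mul, Ideal.Quotient.eq_zero_iff_mem] at hw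
    exact Ideal.Quotient.eq_zero_iff_mem.2 (hreg v hw)
  have hinj : Function.Injective (algebraMap (R₃ ⧸ I) (Localization.Away l)) :=
    IsLocalization.injective _ (Submonoid.powers_le.2 hl)
  let t : Localization.Away l := IsLocalization.Away.invSelf l
  let g : Fin 3 → Localization.Away l :=
    fun i => algebraMap (R₃ ⧸ I) (Localization.Away l) (Ideal.Quotient.mk I (X i))
  have hg : aeval (R := ℂ) g = ((Algebra.algHom ℂ (R₃ ⧸ I) (Localization.Away l))).comp
      (Ideal.Quotient.mkₐ ℂ I) := by
    ext i
    simp only [aeval_X]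
    rfl
  have hg' (G : R₃) :
      aeval g G = algebraMap (R₃ ⧸ I) (Localization.Away l) (Ideal.Quotient.mk I G) := by
    rw [hg]; rfl
  have hker : chartIdeal P Q L ≤ RingHom.ker (aeval (R := ℂ) fun i => g i * t) := by
    rw [chartIdeal, Ideal.span_le]
    rintro G (rfl | rfl | rfl)
    · rw [SetLike.mem_coe, RingHom.mem_ker, aeval_mul_of_isHomogeneous hP, hg',
        Ideal.Quotient.eq_zero_iff_mem.2 (Ideal.subset_span (by simp)), map_zero, zero_mul]
    · rw [SetLike.mem_coe, RingHom.mem_ker, aeval_mul_of_isHomogeneous hQ, hg',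
        Ideal.Quotient.eq_zero_iff_mem.2 (Ideal.subset_span (by simp)), map_zero, zero_mul]
    · rw [SetLike.mem_coe, RingHom.mem_ker, map_sub, aeval_mul_of_isHomogeneous hL, hg', map_one,
        pow_one, IsLocalization.Away.mul_invSelf, sub_self]
  have h0 := hker h
  rw [RingHom.mem_ker, aeval_mul_of_isHomogeneous hF, hg'] at h0
  have ht : IsUnit (t ^ n) := (IsUnit.of_mul_eq_one_right _
    (IsLocalization.Away.mul_invSelf (S := Localization.Away l) l)).pow n
  rw [ht.mul_left_eq_zero, map_eq_zero_iff _ hinj] at h0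
  exact Ideal.Quotient.eq_zero_iff_mem.1 h0

/-- The image in the coordinate ring of the chart `{L = 1}` of the forms of degree `n`. -/
noncomputable def formImage (P Q L : R₃) (n : ℕ) : Submodule ℂ (R₃ ⧸ chartIdeal P Q L) :=
  (homogeneousSubmodule (Fin 3) ℂ n).map (Ideal.Quotient.mkₐ ℂ (chartIdeal P Q L)).toLinearMap

theorem mem_formImage {w : R₃ ⧸ chartIdeal P Q L} : w ∈ formImage P Q L n ↔
    ∃ F : R₃, F.IsHomogeneous n ∧ Ideal.Quotient.mk (chartIdeal P Q L) F = w := Iff.rfl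

instance finite_formImage : Module.Finite ℂ (formImage P Q L n) := by
  unfold formImage
  infer_instance

theorem mk_L_eq_one : Ideal.Quotient.mk (chartIdeal P Q L) L = 1 := by
  rw [← sub_eq_zero, ← map_one (Ideal.Quotient.mk _), ← map_sub, Ideal.Quotient.eq_zero_iff_mem]
  exact Ideal.subset_span (by simp)

theorem formImage_mono (hL : L.IsHomogeneous 1) : Monotone (formImage P Q L) := by
  refine monotone_nat_of_le_succ fun n w hw => ?_
  obtain ⟨F, hF, rfl⟩ := mem_formImage.1 hw
  exact mem_formImage.2 ⟨F * L, hF.mul hL, by rw [map_mul, mk_L_eq_one, mul_one]⟩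

theorem span_pair_le_chartIdeal : Ideal.span {P, Q} ≤ chartIdeal P Q L :=
  Ideal.span_mono (by simp [Set.insert_subset_iff])

/-- The hypotheses on a pair of forms and a linear form that make the chart `{L = 1}`
contain all common zeros. -/
structure IsRegularTriple (P Q L : R₃) (m : ℕ) : Prop where
  hP : P.IsHomogeneous m
  hQ : Q.IsHomogeneous m
  hL : L.IsHomogeneous 1
  hP0 : P ≠ 0
  hQ0 : Q ≠ 0
  hPQ : IsRelPrime P Q
  hreg : ∀ v : R₃, L * v ∈ Ideal.span {P, Q} → v ∈ Ideal.span {P, Q}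

theorem IsRegularTriple.finrank_formImage (h : IsRegularTriple P Q L m) (j : ℕ) :
    Module.finrank ℂ (formImage P Q L (m + j + m)) = m ^ 2 := by
  set H := homogeneousSubmodule (Fin 3) ℂ (m + j + m)
  set f := (Ideal.Quotient.mkₐ ℂ (chartIdeal P Q L)).toLinearMap
  have h1 := (f.domRestrict H).finrank_range_add_finrank_ker
  have h2 : (LinearMap.ker (f.domRestrict H)).map H.subtype =
      H ⊓ (Ideal.span {P, Q}).restrictScalars ℂ := by
    ext F
    simp only [Submodule.mem_map, LinearMap.mem_ker, Submodule.mem_inf,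
      Submodule.restrictScalars_mem, Submodule.subtype_apply]
    constructor
    · rintro ⟨G, hG, rfl⟩
      exact ⟨G.2, mem_span_of_mem_chartIdeal h.hP h.hQ h.hL h.hreg G.2
        (Ideal.Quotient.eq_zero_iff_mem.1 hG)⟩
    · rintro ⟨hF, hFI⟩
      exact ⟨⟨F, hF⟩, Ideal.Quotient.eq_zero_iff_mem.2 (span_pair_le_chartIdeal hFI), rfl⟩
  have h3 := finrank_homogeneousSubmodule_inf_span (j := j) h.hP h.hQ h.hP0 h.hQ0 h.hPQ
  rw [← h2, (Submodule.equivMapOfInjective H.subtype H.injective_subtype _).symm.finrank_eq,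
    ← finrank_homogeneousSubmodule] at h3
  rw [LinearMap.range_domRestrict] at h1
  change Module.finrank ℂ (H.map f) = m ^ 2
  change Module.finrank ℂ (H.map f) + _ = Module.finrank ℂ H at h1
  change _ = Module.finrank ℂ H at h3
  omega

theorem IsRegularTriple.formImage_eq_top (h : IsRegularTriple P Q L m) (hn : m + m ≤ n) :
    formImage P Q L n = ⊤ := by
  have key (N : ℕ) (hN : m + m ≤ N) : formImage P Q L (m + m) = formImage P Q L N := by
    refine Submodule.eq_of_le_of_finrank_eq (formImage_mono h.hL hN) ?_
    obtain ⟨j, rfl⟩ := Nat.exists_eq_add_of_le hN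
    rw [show m + m + j = m + j + m by ring, h.finrank_formImage, ← h.finrank_formImage 0, add_zero]
  rw [← key n hn, eq_top_iff]
  rintro w -
  obtain ⟨F, rfl⟩ := Ideal.Quotient.mk_surjective w
  rw [← sum_homogeneousComponent F, map_sum]
  refine Submodule.sum_mem _ fun i _ => ?_
  rw [key (i + (m + m)) (by omega)]
  exact formImage_mono h.hL (Nat.le_add_right _ _)
    (mem_formImage.2 ⟨_, homogeneousComponent_isHomogeneous i F, rfl⟩)

theorem IsRegularTriple.finite (h : IsRegularTriple P Q L m) :
    Module.Finite ℂ (R₃ ⧸ chartIdeal P Q L) := by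
  rw [Module.finite_def, ← h.formImage_eq_top le_rfl]
  exact Module.Finite.iff_fg.1 inferInstance

theorem IsRegularTriple.finrank (h : IsRegularTriple P Q L m) :
    Module.finrank ℂ (R₃ ⧸ chartIdeal P Q L) = m ^ 2 := by
  rw [← finrank_top, ← h.formImage_eq_top (n := m + 0 + m) (by omega), h.finrank_formImage]

theorem IsRegularTriple.eq_zero_of_eval_eq_zero (h : IsRegularTriple P Q L m) {p : Fin 3 → ℂ}
    (hp : eval p P = 0) (hq : eval p Q = 0) (hl : eval p L = 0) : p = 0 := by
  funext i
  have h1 : Ideal.Quotient.mk (chartIdeal P Q L) (X i ^ (m + m + 1)) ∈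
      formImage P Q L (m + m) := by
    rw [h.formImage_eq_top le_rfl]
    trivial
  obtain ⟨G, hG, hGe⟩ := mem_formImage.1 h1
  have h2 : L * G - X i ^ (m + m + 1) ∈ Ideal.span {P, Q} := by
    refine mem_span_of_mem_chartIdeal (n := m + m + 1) h.hP h.hQ h.hL h.hreg ?_ ?_
    · refine IsHomogeneous.sub ?_ (isHomogeneous_X_pow _ _)
      rw [add_comm (m + m)]
      exact h.hL.mul hG
    · rw [← Ideal.Quotient.eq_zero_iff_mem, map_sub, map_mul, mk_L_eq_one, one_mul, hGe, sub_self]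
  obtain ⟨a, b, hab⟩ := Ideal.mem_span_pair.1 h2
  have h3 := congrArg (eval p) hab
  simp only [map_add, map_mul, map_sub, map_pow, eval_X, hp, hq, hl, mul_zero, zero_mul, add_zero,
    zero_sub] at h3
  exact pow_eq_zero_iff (by omega) |>.1 (neg_eq_zero.1 h3.symm)

end Chart

section Expansion

/-- The homogeneous component of degree `n` of a power series, as a polynomial. -/
noncomputable def form (n : ℕ) (F : MvPowerSeries (Fin 3) ℂ) : R₃ :=
  homogeneousComponent n (MvPowerSeries.truncTotal (n + 1) F)

theorem coeff_form (n : ℕ) (F : MvPowerSeries (Fin 3) ℂ) (e : Fin 3 →₀ ℕ) :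
    coeff e (form n F) = if e.degree = n then MvPowerSeries.coeff e F else 0 := by
  rw [form, coeff_homogeneousComponent]
  split_ifs with h
  · exact MvPowerSeries.coeff_truncTotal F (by omega)
  · rfl

theorem isHomogeneous_form (n : ℕ) (F : MvPowerSeries (Fin 3) ℂ) : (form n F).IsHomogeneous n :=
  homogeneousComponent_isHomogeneous _ _

theorem form_mul (n : ℕ) (F G : MvPowerSeries (Fin 3) ℂ) :
    form n (F * G) = ∑ p ∈ Finset.HasAntidiagonal.antidiagonal n, form p.1 F * form p.2 G := by
  classical
  ext e
  simp only [coeff_form, coeff_sum, coeff_mul, MvPowerSeries.coeff_mul]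
  rw [Finset.sum_comm]
  split_ifs with h
  · refine Finset.sum_congr rfl fun q hq => ?_
    have hq' : q.1.degree + q.2.degree = n := by
      rw [← h, ← Finset.HasAntidiagonal.mem_antidiagonal.1 hq, map_add]
    rw [Finset.sum_eq_single (q.1.degree, q.2.degree)]
    · simp
    · rintro ⟨i, j⟩ - hij
      by_cases h1 : q.1.degree = i
      · by_cases h2 : q.2.degree = j
        · exact absurd (by rw [h1, h2]) hij
        · simp [h2]
      · simp [h1]
    · intro h1
      exact absurd (Finset.HasAntidiagonal.mem_antidiagonal.2 hq') h1
  · refine (Finset.sum_eq_zero fun q hq => Finset.sum_eq_zero fun p hp => ?_).symm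
    rw [Finset.HasAntidiagonal.mem_antidiagonal] at hq hp
    by_cases h1 : q.1.degree = p.1
    · have h2 : q.2.degree ≠ p.2 := by
        intro h2
        apply h
        rw [← hq, map_add, h1, h2, hp]
      simp [h2]
    · simp [h1]

theorem form_toMvPowerSeries (n : ℕ) (F : R₃) :
    form n F.toMvPowerSeries = homogeneousComponent n F := by
  ext e
  rw [coeff_form, coeff_homogeneousComponent, MvPolynomial.coeff_coe]

theorem ext_form {F G : MvPowerSeries (Fin 3) ℂ} (h : ∀ n, form n F = form n G) : F = G := by
  ext e
  have := congrArg (coeff e) (h e.degree)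
  simpa [coeff_form] using this

/-- The expansion of a power series in its homogeneous components. -/
noncomputable def formExpansion : MvPowerSeries (Fin 3) ℂ →ₐ[ℂ] PowerSeries R₃ where
  toFun F := PowerSeries.mk fun n => form n F
  map_one' := by
    ext n : 1
    rw [PowerSeries.coeff_mk, ← MvPolynomial.coe_one, form_toMvPowerSeries, PowerSeries.coeff_one,
      homogeneousComponent_of_mem (isHomogeneous_one _ _ : _ ∈ homogeneousSubmodule _ _ _)]
  map_mul' F G := by
    ext n : 1
    simp only [PowerSeries.coeff_mk, PowerSeries.coeff_mul, form_mul]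
  map_zero' := by
    ext n : 1
    simp [form]
  map_add' F G := by
    ext n : 1
    simp [form]
  commutes' r := by
    ext n : 1
    rw [PowerSeries.coeff_mk, MvPowerSeries.algebraMap_apply, ← MvPolynomial.coe_C,
      form_toMvPowerSeries, PowerSeries.algebraMap_apply, PowerSeries.coeff_C,
      homogeneousComponent_of_mem (isHomogeneous_C _ _ : _ ∈ homogeneousSubmodule _ _ _)]
    rfl

theorem coeff_formExpansion (n : ℕ) (F : MvPowerSeries (Fin 3) ℂ) :
    PowerSeries.coeff n (formExpansion F) = form n F := by
  simp [formExpansion]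

theorem formExpansion_of_isHomogeneous {P : R₃} {m : ℕ} (hP : P.IsHomogeneous m) :
    formExpansion P.toMvPowerSeries = PowerSeries.C P * PowerSeries.X ^ m := by
  ext n : 1
  rw [coeff_formExpansion, form_toMvPowerSeries, PowerSeries.coeff_C_mul_X_pow,
    homogeneousComponent_of_mem (hP : _ ∈ homogeneousSubmodule _ _ _)]

theorem form_mul_toMvPowerSeries {P : R₃} {m : ℕ} (hP : P.IsHomogeneous m)
    (F : MvPowerSeries (Fin 3) ℂ) (n : ℕ) :
    form n (F * P.toMvPowerSeries) = if m ≤ n then form (n - m) F * P else 0 := by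
  rw [← coeff_formExpansion, map_mul, formExpansion_of_isHomogeneous hP, ← mul_assoc,
    PowerSeries.coeff_mul_X_pow']
  split_ifs
  · rw [PowerSeries.coeff_mul_C, coeff_formExpansion]
  · rfl

/-- The power series with prescribed homogeneous components. -/
theorem exists_form_eq (a : ℕ → R₃) (ha : ∀ n, (a n).IsHomogeneous n) :
    ∃ F : MvPowerSeries (Fin 3) ℂ, ∀ n, form n F = a n := by
  let F : MvPowerSeries (Fin 3) ℂ := fun e => coeff e (a e.degree)
  have hF (e) : MvPowerSeries.coeff e F = coeff e (a e.degree) := rfl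
  refine ⟨F, fun n => ?_⟩
  ext e
  rw [coeff_form, hF]
  split_ifs with h
  · subst h
    rfl
  · exact ((ha n).coeff_eq_zero h).symm

theorem mem_span_of_form_mem {P Q : R₃} {m : ℕ} (hP : P.IsHomogeneous m) (hQ : Q.IsHomogeneous m)
    {F : MvPowerSeries (Fin 3) ℂ} (hF : ∀ n, form n F ∈ Ideal.span {P, Q}) :
    ∃ a b, a * P.toMvPowerSeries + b * Q.toMvPowerSeries = F := by
  have (n : ℕ) := exists_homogeneous_of_mem_span_pair hP hQ (isHomogeneous_form (n + m) F)
    (hF (n + m))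
  choose a b ha hb hab using this
  obtain ⟨A, hA⟩ := exists_form_eq a ha
  obtain ⟨B, hB⟩ := exists_form_eq b hb
  refine ⟨A, B, ext_form fun n => ?_⟩
  rw [← coeff_formExpansion, map_add, map_add, coeff_formExpansion, coeff_formExpansion,
    form_mul_toMvPowerSeries hP, form_mul_toMvPowerSeries hQ]
  split_ifs with h
  · rw [hA, hB, hab, Nat.sub_add_cancel h]
  · rw [add_zero, eq_zero_of_mem_span_pair_of_lt hP hQ (isHomogeneous_form n F) (by omega) (hF n)]

end Expansion

section Geometry

theorem three_le_height_ker_eval_zero :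
    3 ≤ (RingHom.ker (aeval (0 : Fin 3 → ℂ) : R₃ →ₐ[ℂ] ℂ)).height := by
  have key {f g : R₃ →ₐ[ℂ] R₃} (h : g.comp f = g) (i : Fin 3) (hg : g (X i) = 0)
      (hf : f (X i) ≠ 0) : (RingHom.ker f).height + 1 ≤ (RingHom.ker g).height := by
    have : (RingHom.ker f).IsPrime := RingHom.ker_isPrime f
    have : (RingHom.ker g).IsPrime := RingHom.ker_isPrime g
    refine Ideal.height_add_one_le_of_lt_of_isPrime (lt_of_le_of_ne (fun v hv => ?_) fun e => hf ?_)
    · rw [RingHom.mem_ker] at hv ⊢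
      rw [← h, AlgHom.comp_apply, hv, map_zero]
    · rw [← RingHom.mem_ker, e]
      exact hg
  let f₁ : R₃ →ₐ[ℂ] R₃ := aeval ![0, X 1, X 2]
  let f₂ : R₃ →ₐ[ℂ] R₃ := aeval ![0, 0, X 2]
  let f₃ : R₃ →ₐ[ℂ] R₃ := aeval ![0, 0, 0]
  have h₁ := key (f := AlgHom.id ℂ R₃) (g := f₁) (by simp) 0 (by simp [f₁]) (by simp)
  have h₂ := key (f := f₁) (g := f₂) (by ext i; fin_cases i <;> simp [f₁, f₂]) 1 (by simp [f₂])
    (by simp [f₁])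
  have h₃ := key (f := f₂) (g := f₃) (by ext i; fin_cases i <;> simp [f₂, f₃]) 2 (by simp [f₃])
    (by simp [f₂])
  have h₄ : RingHom.ker f₃ = RingHom.ker (aeval (0 : Fin 3 → ℂ) : R₃ →ₐ[ℂ] ℂ) := by
    have : f₃ = (Algebra.ofId ℂ R₃).comp (aeval (0 : Fin 3 → ℂ)) := by
      ext i; fin_cases i <;> simp [f₃]
    ext v
    rw [RingHom.mem_ker, RingHom.mem_ker, this, AlgHom.comp_apply]
    exact map_eq_zero_iff _ (FaithfulSMul.algebraMap_injective ℂ R₃)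
  rw [← h₄]
  calc (3 : ℕ∞) = 0 + 1 + 1 + 1 := by norm_num
    _ ≤ _ := by
      refine le_trans ?_ h₃
      gcongr
      refine le_trans ?_ h₂
      gcongr
      refine le_trans ?_ h₁
      gcongr
      exact bot_le

theorem exists_ne_zero_eval_eq_zero {g h : R₃} (hg : aeval (0 : Fin 3 → ℂ) g = 0)
    (hh : aeval (0 : Fin 3 → ℂ) h = 0) :
    ∃ q : Fin 3 → ℂ, q ≠ 0 ∧ aeval q g = 0 ∧ aeval q h = 0 := by
  classical
  have hprime : (RingHom.ker (aeval (0 : Fin 3 → ℂ) : R₃ →ₐ[ℂ] ℂ)).IsPrime :=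
    RingHom.ker_isPrime _
  obtain ⟨p, hp, hle⟩ := Ideal.exists_minimalPrimes_le (I := Ideal.span {g, h})
    (J := RingHom.ker (aeval (0 : Fin 3 → ℂ) : R₃ →ₐ[ℂ] ℂ))
    (by rw [Ideal.span_le]; rintro v (rfl | rfl) <;> assumption)
  have hpp : p.IsPrime := hp.1.1
  have hht : p.height ≤ 2 := by
    have := Ideal.height_le_card_of_mem_minimalPrimes_span_finset (s := {g, h}) (p := p)
      (by simpa using hp)
    exact this.trans (by exact_mod_cast Finset.card_le_two)
  have hmem : g ∈ p ∧ h ∈ p :=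
    ⟨hp.1.2 (Ideal.subset_span (by simp)), hp.1.2 (Ideal.subset_span (by simp))⟩
  by_contra! hcon
  have hz : ∀ x ∈ zeroLocus ℂ p, x = 0 := by
    intro x hx
    by_contra hx0
    exact hcon x hx0 (hx g hmem.1) (hx h hmem.2)
  have heq : p = RingHom.ker (aeval (0 : Fin 3 → ℂ) : R₃ →ₐ[ℂ] ℂ) := by
    refine le_antisymm hle fun v hv => ?_
    rw [← MvPolynomial.IsPrime.vanishingIdeal_zeroLocus (K := ℂ) p]
    intro x hx
    rw [hz x hx]
    exact hv
  rw [heq] at hht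
  exact absurd (three_le_height_ker_eval_zero.trans hht) (by decide)

/-- The substitution `xᵢ ↦ xᵢT`. -/
noncomputable def scaling : R₃ →ₐ[ℂ] Polynomial R₃ :=
  aeval fun i => Polynomial.C (X i) * Polynomial.X

theorem scaling_of_isHomogeneous {F : R₃} {n : ℕ} (hF : F.IsHomogeneous n) :
    scaling F = Polynomial.C F * Polynomial.X ^ n := by
  have h (v : R₃) : aeval (fun i => Polynomial.C (X i : R₃)) v = Polynomial.C v := by
    induction v using MvPolynomial.induction_on with
    | C a => rw [aeval_C]; rfl
    | add p q hp hq => rw [map_add, map_add, hp, hq]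
    | mul_X p i hp => rw [map_mul, map_mul, hp, aeval_X]
  rw [scaling, aeval_mul_of_isHomogeneous hF (fun i => Polynomial.C (X i : R₃)) Polynomial.X, h]

theorem eval_one_scaling (v : R₃) : (scaling v).eval 1 = v := by
  have : ((Polynomial.aeval (1 : R₃)).restrictScalars ℂ).comp scaling = AlgHom.id ℂ R₃ := by
    ext i; simp [scaling]
  simpa [Polynomial.coe_aeval_eq_eval] using DFunLike.congr_fun this v

theorem coeff_zero_scaling (v : R₃) :
    (scaling v).coeff 0 = C (aeval (0 : Fin 3 → ℂ) v) := by
  have : ((Polynomial.aeval (0 : R₃)).restrictScalars ℂ).comp scaling =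
      (Algebra.ofId ℂ R₃).comp (aeval (0 : Fin 3 → ℂ)) := by
    ext i; simp [scaling, Algebra.ofId_apply]
  have := DFunLike.congr_fun this v
  rw [Polynomial.coeff_zero_eq_eval_zero]
  simpa [Polynomial.coe_aeval_eq_eval, Algebra.ofId_apply, algebraMap_eq] using this

theorem aeval_zero_of_dvd {F h : R₃} {n : ℕ} (hF : F.IsHomogeneous n) (hF0 : F ≠ 0) (hdvd : h ∣ F)
    (hu : ¬ IsUnit h) : aeval (0 : Fin 3 → ℂ) h = 0 := by
  by_contra h0
  obtain ⟨a, rfl⟩ := hdvd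
  have hF' : scaling h * scaling a = Polynomial.C (h * a) * Polynomial.X ^ n := by
    rw [← map_mul, scaling_of_isHomogeneous hF]
  have hX : ¬ Polynomial.X ∣ scaling h := by
    rw [Polynomial.X_dvd_iff, coeff_zero_scaling, C_eq_zero]
    exact h0
  obtain ⟨b, hb⟩ := Polynomial.prime_X.pow_dvd_of_dvd_mul_left n hX
    (hF' ▸ Dvd.intro_left _ rfl : Polynomial.X ^ n ∣ scaling h * scaling a)
  have hc : scaling h * b = Polynomial.C (h * a) := by
    rw [hb, mul_left_comm, mul_comm] at hF'
    exact mul_right_cancel₀ (pow_ne_zero _ Polynomial.X_ne_zero) hF'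
  have hdeg : (scaling h).natDegree = 0 := by
    have hd : (scaling h * b).natDegree = 0 := by rw [hc, Polynomial.natDegree_C]
    have hne : scaling h * b ≠ 0 := by rwa [hc, Ne, Polynomial.C_eq_zero]
    rw [Polynomial.natDegree_mul (left_ne_zero_of_mul hne) (right_ne_zero_of_mul hne)] at hd
    omega
  apply hu
  rw [← eval_one_scaling h, Polynomial.eq_C_of_natDegree_eq_zero hdeg, coeff_zero_scaling,
    Polynomial.eval_C]
  exact (isUnit_iff_ne_zero.2 h0).map C

theorem dehom0_eval (F : R₃) (u : Fin 2 → ℂ) :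
    eval u (dehom0 F) = aeval ![1, u 0, u 1] F := by
  have : (aeval u).comp (aeval ![1, X 0, X 1] : R₃ →ₐ[ℂ] MvPolynomial (Fin 2) ℂ) =
      aeval ![1, u 0, u 1] := by
    ext i; fin_cases i <;> simp
  exact DFunLike.congr_fun this F

theorem pderiv_dehom0 (F : R₃) (j : Fin 2) :
    pderiv j (dehom0 F) = dehom0 (pderiv j.succ F) := by
  unfold dehom0
  induction F using MvPolynomial.induction_on with
  | C a => simp
  | add p q hp hq => rw [map_add, map_add, hp, hq, map_add, map_add]
  | mul_X p i hp =>
    fin_cases i <;> fin_cases j <;> simp_all [Derivation.leibniz, pderiv_X]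

theorem aeval_smul_of_isHomogeneous {F : R₃} {n : ℕ} (hF : F.IsHomogeneous n) (q : Fin 3 → ℂ)
    (t : ℂ) : aeval (t • q) F = t ^ n * aeval q F := by
  have := aeval_mul_of_isHomogeneous hF q t
  rw [mul_comm, ← this]
  congr 2
  ext i
  simp [mul_comm]

end Geometry

theorem affine_point {q : Fin 3 → ℂ} (hq : q 0 ≠ 0) :
    (![1, q 1 / q 0, q 2 / q 0] : Fin 3 → ℂ) = (q 0)⁻¹ • q := by
  ext i; fin_cases i <;> simp [hq, div_eq_inv_mul]

/-- The hypotheses on the homogeneous form `F` of degree `m + 1`: it is convenient, and all the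
singular points of the curve `F = 0` are nodes in the chart `{x₀ ≠ 0}`. -/
structure IsNodal (F : R₃) (m : ℕ) : Prop where
  two_le : 2 ≤ m
  hhom : F.IsHomogeneous (m + 1)
  hconv : ∀ i : Fin 3, coeff (Finsupp.single i (m + 1)) F ≠ 0
  haff : ∀ p : Fin 3 → ℂ, p ≠ 0 → eval p F = 0 → (∀ i, eval p (pderiv i F) = 0) → p 0 ≠ 0
  hnode : ∀ q : Fin 2 → ℂ, eval q (dehom0 F) = 0 →
      (∀ j, eval q (pderiv j (dehom0 F)) = 0) →
      Matrix.det !![eval q (pderiv 0 (pderiv 0 (dehom0 F))),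
          eval q (pderiv 1 (pderiv 0 (dehom0 F)));
          eval q (pderiv 0 (pderiv 1 (dehom0 F))),
          eval q (pderiv 1 (pderiv 1 (dehom0 F)))] ≠ 0

namespace IsNodal

variable {F : R₃} {m : ℕ}

theorem isHomogeneous_pderiv (h : IsNodal F m) (i : Fin 3) : (pderiv i F).IsHomogeneous m :=
  h.hhom.pderiv

theorem aeval_eq_zero (h : IsNodal F m) {q : Fin 3 → ℂ} (hq : ∀ i, aeval q (pderiv i F) = 0) :
    aeval q F = 0 := by
  have := congrArg (aeval q) h.hhom.sum_X_mul_pderiv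
  simp only [map_sum, map_mul, hq, mul_zero, Finset.sum_const_zero, map_nsmul] at this
  simpa [Nat.cast_add_one_ne_zero] using this.symm

theorem zero_ne_zero (h : IsNodal F m) {q : Fin 3 → ℂ} (hq : ∀ i, aeval q (pderiv i F) = 0)
    (hq0 : q ≠ 0) : q 0 ≠ 0 :=
  h.haff q hq0 (by simpa [coe_aeval_eq_eval] using h.aeval_eq_zero hq)
    (by simpa [coe_aeval_eq_eval] using hq)

theorem hessian_ne_zero (h : IsNodal F m) {q : Fin 3 → ℂ} (hq : ∀ i, aeval q (pderiv i F) = 0)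
    (hq0 : q ≠ 0) :
    aeval q (pderiv 1 (pderiv 1 F)) * aeval q (pderiv 2 (pderiv 2 F)) -
      aeval q (pderiv 2 (pderiv 1 F)) * aeval q (pderiv 1 (pderiv 2 F)) ≠ 0 := by
  have h0 := h.zero_ne_zero hq hq0
  have hn := h.hnode ![q 1 / q 0, q 2 / q 0]
    (by
      rw [dehom0_eval]
      simp only [Matrix.cons_val_zero, Matrix.cons_val_one]
      rw [affine_point h0, aeval_smul_of_isHomogeneous h.hhom, h.aeval_eq_zero hq, mul_zero])
    (fun j => by
      rw [pderiv_dehom0, dehom0_eval]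
      simp only [Matrix.cons_val_zero, Matrix.cons_val_one]
      rw [affine_point h0, aeval_smul_of_isHomogeneous (h.isHomogeneous_pderiv _), hq, mul_zero])
  rw [Matrix.det_fin_two_of] at hn
  simp only [pderiv_dehom0, dehom0_eval, Matrix.cons_val_zero, Matrix.cons_val_one] at hn
  rw [affine_point h0] at hn
  have hh (i j : Fin 3) : (pderiv j (pderiv i F)).IsHomogeneous (m - 1) :=
    (h.isHomogeneous_pderiv i).pderiv
  simp only [aeval_smul_of_isHomogeneous (hh _ _)] at hn
  intro h1
  apply hn
  simp only [Fin.succ_zero_eq_one, Fin.succ_one_eq_two]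
  linear_combination ((q 0)⁻¹ ^ (m - 1)) ^ 2 * h1

theorem coeff_pderiv_ne_zero (h : IsNodal F m) (i : Fin 3) :
    coeff (Finsupp.single i m) (pderiv i F) ≠ 0 := by
  rw [coeff_pderiv, ← Finsupp.single_add]
  refine mul_ne_zero (h.hconv i) ?_
  simp [Nat.cast_add_one_ne_zero]

theorem pderiv_ne_zero (h : IsNodal F m) (i : Fin 3) : pderiv i F ≠ 0 := by
  intro h0
  apply h.coeff_pderiv_ne_zero i
  rw [h0, coeff_zero]

theorem isRelPrime (h : IsNodal F m) : IsRelPrime (pderiv 1 F) (pderiv 2 F) := by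
  intro g h1 h2
  by_contra hu
  have hg := aeval_zero_of_dvd (h.isHomogeneous_pderiv 1) (h.pderiv_ne_zero 1) h1 hu
  have hm : 0 ≠ m := by have := h.two_le; omega
  have h0 : aeval (0 : Fin 3 → ℂ) (pderiv 0 F) = 0 := by
    rw [← zero_smul ℂ (0 : Fin 3 → ℂ), aeval_smul_of_isHomogeneous (h.isHomogeneous_pderiv 0),
      zero_pow hm.symm, zero_mul]
  obtain ⟨q, hq0, hqg, hq⟩ := exists_ne_zero_eval_eq_zero hg h0
  obtain ⟨a, ha⟩ := h1
  obtain ⟨b, hb⟩ := h2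
  have hall : ∀ i, aeval q (pderiv i F) = 0 := by
    intro i
    fin_cases i
    · exact hq
    · change aeval q (pderiv 1 F) = 0
      rw [ha, map_mul, hqg, zero_mul]
    · change aeval q (pderiv 2 F) = 0
      rw [hb, map_mul, hqg, zero_mul]
  apply h.hessian_ne_zero hall hq0
  rw [ha, hb]
  simp only [Derivation.leibniz, map_add, smul_eq_mul, map_mul, hqg]
  ring

theorem exists_isRegularTriple (h : IsNodal F m) :
    ∃ l : ℂ, IsRegularTriple (pderiv 1 F) (pderiv 2 F) (X 0 + C l * X 2) m := by
  obtain ⟨l, hl⟩ := exists_linear_form_regular (h.isHomogeneous_pderiv 1)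
    (h.coeff_pderiv_ne_zero 1) (h.pderiv_ne_zero 2) h.isRelPrime
  refine ⟨l, h.isHomogeneous_pderiv 1, h.isHomogeneous_pderiv 2, ?_, h.pderiv_ne_zero 1,
    h.pderiv_ne_zero 2, h.isRelPrime, hl⟩
  exact (isHomogeneous_X _ _).add (by simpa using (isHomogeneous_C _ l).mul (isHomogeneous_X _ _))

end IsNodal

section Points

theorem sub_sum_mem_sq (v : R₃) (q : Fin 3 → ℂ) :
    v - C (aeval q v) - ∑ i, C (aeval q (pderiv i v)) * (X i - C (q i)) ∈
      (vanishingIdeal ℂ {q} : Ideal R₃) ^ 2 := by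
  have hX (i : Fin 3) : X i - C (q i) ∈ (vanishingIdeal ℂ {q} : Ideal R₃) := by
    rw [mem_vanishingIdeal_singleton_iff]; simp
  induction v using MvPolynomial.induction_on with
  | C a => simp
  | add p p' hp hp' =>
    convert add_mem hp hp' using 1
    simp only [map_add, add_mul, Finset.sum_add_distrib]
    ring
  | mul_X p i hp =>
    have h1 : p - C (aeval q p) ∈ (vanishingIdeal ℂ {q} : Ideal R₃) := by
      rw [mem_vanishingIdeal_singleton_iff]; simp
    have h2 : (p - C (aeval q p)) * (X i - C (q i)) ∈ (vanishingIdeal ℂ {q} : Ideal R₃) ^ 2 := by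
      rw [pow_two]
      exact Ideal.mul_mem_mul h1 (hX i)
    convert add_mem (Ideal.mul_mem_left _ (C (q i)) hp) h2 using 1
    have h3 : ∑ j, C (aeval q (pderiv j (p * X i))) * (X j - C (q j)) =
        C (q i) * ∑ j, C (aeval q (pderiv j p)) * (X j - C (q j)) +
          C (aeval q p) * (X i - C (q i)) := by
      simp only [Derivation.leibniz, pderiv_X, map_add, smul_eq_mul, map_mul, aeval_X, add_mul,
        Finset.sum_add_distrib]
      rw [add_comm]
      congr 1
      · rw [Finset.mul_sum]
        exact Finset.sum_congr rfl fun j _ => by ring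
      · rw [Finset.sum_eq_single i]
        · simp
        · intro j _ hj
          simp [hj.symm]
        · simp
    rw [h3]
    simp only [map_mul, aeval_X]
    ring

theorem vanishingIdeal_le_sup_sq {I : Ideal R₃} {q : Fin 3 → ℂ} (g : Fin 3 → R₃)
    (hg : ∀ i, g i ∈ I) (hgq : ∀ i, aeval q (g i) = 0)
    (hdet : (Matrix.of fun k i => aeval q (pderiv i (g k))).det ≠ 0) :
    vanishingIdeal ℂ {q} ≤ I ⊔ (vanishingIdeal ℂ {q} : Ideal R₃) ^ 2 := by
  set A : Matrix (Fin 3) (Fin 3) ℂ := Matrix.of fun k i => aeval q (pderiv i (g k)) with hA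
  set K := I ⊔ (vanishingIdeal ℂ {q} : Ideal R₃) ^ 2
  have h1 (v : R₃) (hv : aeval q v = 0) (hvK : v ∈ K) :
      ∑ i, C (aeval q (pderiv i v)) * (X i - C (q i)) ∈ K := by
    have h6 : _ ∈ K := Ideal.mem_sup_right (sub_sum_mem_sq v q)
    have := sub_mem hvK h6
    rw [hv] at this
    simpa using this
  have h2 (j : Fin 3) : X j - C (q j) ∈ K := by
    have h3 : X j - C (q j) = ∑ k, C (A⁻¹ j k) * ∑ i, C (A k i) * (X i - C (q i)) := by
      simp only [Finset.mul_sum]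
      rw [Finset.sum_comm]
      have h4 (i : Fin 3) : ∑ k, C (A⁻¹ j k) * (C (A k i) * (X i - C (q i))) =
          C ((1 : Matrix (Fin 3) (Fin 3) ℂ) j i) * (X i - C (q i)) := by
        rw [← Matrix.nonsing_inv_mul A (isUnit_iff_ne_zero.2 hdet), Matrix.mul_apply, map_sum,
          Finset.sum_mul]
        exact Finset.sum_congr rfl fun k _ => by rw [map_mul]; ring
      simp only [h4]
      rw [Finset.sum_eq_single j]
      · simp
      · intro i _ hi
        simp [hi.symm]
      · simp
    rw [h3]
    refine sum_mem fun k _ => Ideal.mul_mem_left _ _ ?_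
    exact h1 (g k) (hgq k) (Ideal.mem_sup_left (hg k))
  intro v hv
  rw [mem_vanishingIdeal_singleton_iff] at hv
  have h6 : _ ∈ K := Ideal.mem_sup_right (sub_sum_mem_sq v q)
  have h5 := add_mem h6
    (sum_mem fun i (_ : i ∈ Finset.univ) =>
      Ideal.mul_mem_left K (C (aeval q (pderiv i v))) (h2 i))
  rw [hv] at h5
  simpa using h5

theorem le_sup_pow {A : Type*} [CommRing A] {I M : Ideal A} (h : M ≤ I ⊔ M ^ 2) (n : ℕ) :
    M ≤ I ⊔ M ^ (n + 1) := by
  induction n with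
  | zero => simp
  | succ n ih =>
    refine h.trans (sup_le le_sup_left ?_)
    calc M ^ 2 = M * M := pow_two M
      _ ≤ M * (I ⊔ M ^ (n + 1)) := Ideal.mul_mono_right ih
      _ = M * I ⊔ M * M ^ (n + 1) := Ideal.mul_sup _ _ _
      _ ≤ I ⊔ M ^ (n + 1 + 1) := by
        rw [pow_succ' M (n + 1)]
        exact sup_le_sup_right Ideal.mul_le_right _

theorem prod_sup_le {A ι : Type*} [CommRing A] (I : Ideal A) (s : Finset ι) (M : ι → Ideal A) :
    ∏ i ∈ s, (I ⊔ M i) ≤ I ⊔ ∏ i ∈ s, M i := by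
  classical
  induction s using Finset.induction_on with
  | empty => simp
  | insert i s hi ih =>
    rw [Finset.prod_insert hi, Finset.prod_insert hi]
    refine (Ideal.mul_mono_right ih).trans ?_
    rw [Ideal.sup_mul, Ideal.mul_sup (M i)]
    exact sup_le (Ideal.mul_le_left.trans le_sup_left)
      (sup_le_sup_right Ideal.mul_le_right _)

variable {I I₀ : Ideal R₃} {Z : Finset (Fin 3 → ℂ)}

theorem isCoprime_vanishingIdeal {p q : Fin 3 → ℂ} (h : p ≠ q) :
    IsCoprime (vanishingIdeal ℂ {p} : Ideal R₃) (vanishingIdeal ℂ {q}) := by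
  have hp : (vanishingIdeal ℂ {p} : Ideal R₃).IsMaximal :=
    isMaximal_iff_eq_vanishingIdeal_singleton.2 ⟨p, rfl⟩
  have hq : (vanishingIdeal ℂ {q} : Ideal R₃).IsMaximal :=
    isMaximal_iff_eq_vanishingIdeal_singleton.2 ⟨q, rfl⟩
  refine Ideal.isCoprime_of_isMaximal fun e => h ?_
  funext i
  have : X i - C (q i) ∈ (vanishingIdeal ℂ {p} : Ideal R₃) := by
    rw [e, mem_vanishingIdeal_singleton_iff]
    simp
  rw [mem_vanishingIdeal_singleton_iff] at this
  simpa [sub_eq_zero] using this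

theorem vanishingIdeal_eq_prod (Z : Finset (Fin 3 → ℂ)) :
    vanishingIdeal ℂ (Z : Set (Fin 3 → ℂ)) = ∏ q ∈ Z, (vanishingIdeal ℂ {q} : Ideal R₃) := by
  rw [Ideal.prod_eq_iInf_of_pairwise_isCoprime fun p _ q _ h => isCoprime_vanishingIdeal h]
  ext v
  simp [Submodule.mem_iInf, mem_vanishingIdeal_iff]

theorem vanishingIdeal_le_sup_pow (hZ : ∀ q ∈ Z, vanishingIdeal ℂ {q} ≤
      I ⊔ (vanishingIdeal ℂ {q} : Ideal R₃) ^ 2) (n : ℕ) :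
    vanishingIdeal ℂ (Z : Set (Fin 3 → ℂ)) ≤
      I ⊔ (vanishingIdeal ℂ (Z : Set (Fin 3 → ℂ)) : Ideal R₃) ^ (n + 1) := by
  rw [vanishingIdeal_eq_prod, ← Finset.prod_pow]
  refine le_trans ?_ (prod_sup_le I Z _)
  exact Finset.prod_le_prod' fun q hq => le_sup_pow (hZ q hq) n

theorem eq_vanishingIdeal (hZ : ∀ q ∈ Z, vanishingIdeal ℂ {q} ≤
      I ⊔ (vanishingIdeal ℂ {q} : Ideal R₃) ^ 2) (hI : I ≤ I₀)
    (hZ₀ : zeroLocus ℂ I₀ = (Z : Set (Fin 3 → ℂ))) :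
    I₀ = vanishingIdeal ℂ (Z : Set (Fin 3 → ℂ)) := by
  refine le_antisymm ?_ ?_
  · rw [← hZ₀]
    exact le_vanishingIdeal_zeroLocus I₀
  · obtain ⟨n, hn⟩ := Ideal.exists_radical_pow_le_of_fg I₀ (IsNoetherian.noetherian _)
    rw [← vanishingIdeal_zeroLocus_eq_radical (K := ℂ), hZ₀] at hn
    exact (vanishingIdeal_le_sup_pow hZ n).trans
      (sup_le hI ((Ideal.pow_le_pow_right n.le_succ).trans hn))

theorem exists_aeval_eq (Z : Finset (Fin 3 → ℂ)) (z : (Fin 3 → ℂ) → ℂ) :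
    ∃ v : R₃, ∀ q ∈ Z, aeval q v = z q := by
  obtain ⟨v, hv⟩ := Ideal.exists_forall_sub_mem_ideal 
    (I := fun q : Z => (vanishingIdeal ℂ {q.1} : Ideal R₃))
    (fun p q h => isCoprime_vanishingIdeal fun e => h (Subtype.ext e)) (fun q => C (z q.1))
  refine ⟨v, fun q hq => ?_⟩
  have := hv ⟨q, hq⟩
  rw [mem_vanishingIdeal_singleton_iff] at this
  simpa [sub_eq_zero] using this

theorem finrank_quotient_vanishingIdeal (Z : Finset (Fin 3 → ℂ)) :
    Module.finrank ℂ (R₃ ⧸ (vanishingIdeal ℂ (Z : Set (Fin 3 → ℂ)) : Ideal R₃)) = Z.card := by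
  let ev : R₃ →ₐ[ℂ] (Z → ℂ) := AlgHom.pi fun q => aeval q.1
  have hker : RingHom.ker ev = vanishingIdeal ℂ (Z : Set (Fin 3 → ℂ)) := by
    ext v
    rw [RingHom.mem_ker, mem_vanishingIdeal_iff]
    simp [ev, funext_iff]
  have hsurj : Function.Surjective ev := fun z => by
    obtain ⟨v, hv⟩ := exists_aeval_eq Z fun q => if h : q ∈ Z then z ⟨q, h⟩ else 0
    refine ⟨v, funext fun q => ?_⟩
    simpa [ev, q.2] using hv q q.2
  rw [← hker, (Ideal.quotientKerAlgEquivOfSurjective hsurj).toLinearEquiv.finrank_eq]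
  simp

end Points

section Singular

variable {F : R₃} {m : ℕ} {l : ℂ}

/-- The ideal of the singular points of `F = 0` in the affine chart `{L = 1}`. -/
noncomputable def singularIdeal (F L : R₃) : Ideal R₃ :=
  chartIdeal (pderiv 1 F) (pderiv 2 F) L ⊔ Ideal.span {pderiv 0 F}

/-- The singular points of the dehomogenization of `F`. -/
def affineSingularPoints (F : R₃) : Set (Fin 2 → ℂ) :=
  {q : Fin 2 → ℂ | eval q (dehom0 F) = 0 ∧ ∀ j, eval q (pderiv j (dehom0 F)) = 0}

theorem mem_zeroLocus_singularIdeal {L : R₃} {q : Fin 3 → ℂ} :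
    q ∈ zeroLocus ℂ (singularIdeal F L) ↔ (∀ i, aeval q (pderiv i F) = 0) ∧ aeval q L = 1 := by
  constructor
  · intro hq
    refine ⟨fun i => hq _ ?_, ?_⟩
    · fin_cases i
      · exact Ideal.mem_sup_right (Ideal.subset_span rfl)
      · exact Ideal.mem_sup_left (Ideal.subset_span (by simp))
      · exact Ideal.mem_sup_left (Ideal.subset_span (by simp))
    · have := hq (L - 1) (Ideal.mem_sup_left (Ideal.subset_span (by simp)))
      simpa [sub_eq_zero] using this
  · rintro ⟨h1, h2⟩
    have h3 : singularIdeal F L ≤ vanishingIdeal ℂ {q} := by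
      refine sup_le (Ideal.span_le.2 ?_) (Ideal.span_le.2 ?_)
      · rintro v (rfl | rfl | rfl) <;>
          simp only [SetLike.mem_coe, mem_vanishingIdeal_singleton_iff, h1, map_sub, map_one, h2,
            sub_self]
      · rintro v rfl
        simp only [SetLike.mem_coe, mem_vanishingIdeal_singleton_iff, h1]
    intro v hv
    exact (mem_vanishingIdeal_singleton_iff q v).1 (h3 hv)

theorem mem_affineSingularPoints {F : R₃} {u : Fin 2 → ℂ} :
    u ∈ affineSingularPoints F ↔ aeval (![1, u 0, u 1] : Fin 3 → ℂ) F = 0 ∧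
      aeval (![1, u 0, u 1] : Fin 3 → ℂ) (pderiv 1 F) = 0 ∧
      aeval (![1, u 0, u 1] : Fin 3 → ℂ) (pderiv 2 F) = 0 := by
  simp only [affineSingularPoints, Set.mem_ofPred_eq, pderiv_dehom0, dehom0_eval,
    Fin.forall_fin_two]
  rfl

theorem ne_zero_of_aeval_eq_one {q : Fin 3 → ℂ} (h : aeval q (X 0 + C l * X 2 : R₃) = 1) :
    q ≠ 0 := by
  rintro rfl
  simp at h

theorem IsNodal.bijOn_singularPoints (h : IsNodal F m)
    (hR : IsRegularTriple (pderiv 1 F) (pderiv 2 F) (X 0 + C l * X 2) m) :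
    Set.BijOn (fun q : Fin 3 → ℂ => ![q 1 / q 0, q 2 / q 0])
      (zeroLocus ℂ (singularIdeal F (X 0 + C l * X 2))) (affineSingularPoints F) := by
  refine ⟨fun q hq => ?_, fun p hp q hq hpq => ?_, fun u hu => ?_⟩
  · obtain ⟨h1, h2⟩ := mem_zeroLocus_singularIdeal.1 hq
    have hq0 := h.zero_ne_zero h1 (ne_zero_of_aeval_eq_one h2)
    rw [mem_affineSingularPoints]
    simp only [Matrix.cons_val_zero, Matrix.cons_val_one]
    rw [affine_point hq0, aeval_smul_of_isHomogeneous h.hhom,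
      aeval_smul_of_isHomogeneous (h.isHomogeneous_pderiv _),
      aeval_smul_of_isHomogeneous (h.isHomogeneous_pderiv _), h.aeval_eq_zero h1, h1, h1]
    simp
  · obtain ⟨hp1, hp2⟩ := mem_zeroLocus_singularIdeal.1 hp
    obtain ⟨hq1, hq2⟩ := mem_zeroLocus_singularIdeal.1 hq
    have hp0 := h.zero_ne_zero hp1 (ne_zero_of_aeval_eq_one hp2)
    have hq0 := h.zero_ne_zero hq1 (ne_zero_of_aeval_eq_one hq2)
    have e1 : (p 0)⁻¹ • p = (q 0)⁻¹ • q := by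
      rw [← affine_point hp0, ← affine_point hq0]
      have a1 := congrFun hpq 0
      have a2 := congrFun hpq 1
      simp only [Matrix.cons_val_zero, Matrix.cons_val_one] at a1 a2
      rw [a1, a2]
    have e2 : (p 0)⁻¹ = (q 0)⁻¹ := by
      have := congrArg (fun v => aeval v (X 0 + C l * X 2 : R₃)) e1
      simpa only [aeval_smul_of_isHomogeneous hR.hL, hp2, hq2, pow_one, mul_one] using this
    rw [e2] at e1
    exact smul_right_injective _ (inv_ne_zero hq0) e1
  · rw [mem_affineSingularPoints] at hu
    set w : Fin 3 → ℂ := ![1, u 0, u 1] with hw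
    obtain ⟨h0, h1, h2⟩ := hu
    have hP0 : aeval w (pderiv 0 F) = 0 := by
      have := congrArg (aeval w) h.hhom.sum_X_mul_pderiv
      rw [map_nsmul, h0, smul_zero] at this
      rw [Fin.sum_univ_three, map_add, map_add, map_mul, map_mul, map_mul, h1, h2] at this
      simpa [hw] using this
    have hL0 : aeval w (X 0 + C l * X 2 : R₃) ≠ 0 := by
      intro hL
      have := congrFun (hR.eq_zero_of_eval_eq_zero h1 h2 hL) 0
      simp [hw] at this
    set t := aeval w (X 0 + C l * X 2 : R₃)
    refine ⟨t⁻¹ • w, ?_, ?_⟩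
    · rw [mem_zeroLocus_singularIdeal]
      constructor
      · intro i
        rw [aeval_smul_of_isHomogeneous (h.isHomogeneous_pderiv i)]
        fin_cases i
        · simpa using Or.inr hP0
        · simpa using Or.inr h1
        · simpa using Or.inr h2
      · rw [aeval_smul_of_isHomogeneous hR.hL, pow_one]
        exact inv_mul_cancel₀ hL0
    · ext i
      fin_cases i <;> simp [hw] <;> field_simp

theorem IsNodal.vanishingIdeal_le (h : IsNodal F m) {q : Fin 3 → ℂ}
    (hq : ∀ i, aeval q (pderiv i F) = 0) (hL : aeval q (X 0 + C l * X 2 : R₃) = 1) :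
    vanishingIdeal ℂ {q} ≤ chartIdeal (pderiv 1 F) (pderiv 2 F) (X 0 + C l * X 2) ⊔
      (vanishingIdeal ℂ {q} : Ideal R₃) ^ 2 := by
  refine vanishingIdeal_le_sup_sq ![pderiv 1 F, pderiv 2 F, X 0 + C l * X 2 - 1] ?_ ?_ ?_
  · intro i
    fin_cases i <;> exact Ideal.subset_span (by simp)
  · intro i
    fin_cases i
    · exact hq 1
    · exact hq 2
    · change aeval q (X 0 + C l * X 2 - 1 : R₃) = 0
      rw [map_sub, hL, map_one, sub_self]
  · have hn := h.hessian_ne_zero hq (ne_zero_of_aeval_eq_one hL)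
    have e (i : Fin 3) (hi : aeval q (pderiv i F) = 0) :
        q 0 * aeval q (pderiv 0 (pderiv i F)) + q 1 * aeval q (pderiv 1 (pderiv i F)) +
          q 2 * aeval q (pderiv 2 (pderiv i F)) = 0 := by
      have := congrArg (aeval q) (h.isHomogeneous_pderiv i).sum_X_mul_pderiv
      rw [map_nsmul, hi, smul_zero] at this
      simpa only [Fin.sum_univ_three, map_add, map_mul, aeval_X] using this
    have e1 := e 1 (hq 1)
    have e2 := e 2 (hq 2)
    have e3 : q 0 + l * q 2 = 1 := by simpa using hL
    intro hdet
    apply hn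
    have f0 : pderiv 0 (X 0 + C l * X 2 - 1 : R₃) = 1 := by simp [pderiv_X]
    have f1 : pderiv 1 (X 0 + C l * X 2 - 1 : R₃) = 0 := by simp [pderiv_X]
    have f2 : pderiv 2 (X 0 + C l * X 2 - 1 : R₃) = C l := by simp [pderiv_X]
    rw [Matrix.det_fin_three] at hdet
    simp only [Matrix.of_apply, Matrix.cons_val_zero, Matrix.cons_val_one, Matrix.cons_val,
      f0, f1, f2, map_one, map_zero, aeval_C, Algebra.algebraMap_self, RingHom.id_apply] at hdet
    generalize aeval q (pderiv 0 (pderiv 1 F)) = a0 at *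
    generalize aeval q (pderiv 1 (pderiv 1 F)) = a1 at *
    generalize aeval q (pderiv 2 (pderiv 1 F)) = a2 at *
    generalize aeval q (pderiv 0 (pderiv 2 F)) = b0 at *
    generalize aeval q (pderiv 1 (pderiv 2 F)) = b1 at *
    generalize aeval q (pderiv 2 (pderiv 2 F)) = b2 at *
    linear_combination q 0 * hdet - (a1 * b2 - a2 * b1) * e3 - l * b1 * e1 + l * a1 * e2

theorem IsNodal.singularIdeal_spec (h : IsNodal F m)
    (hR : IsRegularTriple (pderiv 1 F) (pderiv 2 F) (X 0 + C l * X 2) m)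
    (hfin : (affineSingularPoints F).Finite) :
    Module.finrank ℂ (R₃ ⧸ singularIdeal F (X 0 + C l * X 2)) = (affineSingularPoints F).ncard ∧
    (∃ s, pderiv 0 F - s * pderiv 0 F ^ 2 ∈
      chartIdeal (pderiv 1 F) (pderiv 2 F) (X 0 + C l * X 2)) ∧
    ∃ y, 1 - X 0 * y ∈ singularIdeal F (X 0 + C l * X 2) := by
  set L : R₃ := X 0 + C l * X 2
  have hbij := h.bijOn_singularPoints hR
  have hZfin : (zeroLocus ℂ (singularIdeal F L)).Finite := hbij.finite_iff_finite.2 hfin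
  have hZ₀ : zeroLocus ℂ (singularIdeal F L) = (hZfin.toFinset : Set (Fin 3 → ℂ)) := by simp
  have hloc : ∀ q ∈ hZfin.toFinset, vanishingIdeal ℂ {q} ≤
      chartIdeal (pderiv 1 F) (pderiv 2 F) L ⊔ (vanishingIdeal ℂ {q} : Ideal R₃) ^ 2 := by
    intro q hq
    obtain ⟨h1, h2⟩ := mem_zeroLocus_singularIdeal.1 (hZfin.mem_toFinset.1 hq)
    exact h.vanishingIdeal_le h1 h2
  have heq : singularIdeal F L = vanishingIdeal ℂ (hZfin.toFinset : Set (Fin 3 → ℂ)) :=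
    eq_vanishingIdeal hloc le_sup_left hZ₀
  refine ⟨?_, ?_, ?_⟩
  · rw [heq, finrank_quotient_vanishingIdeal, ← Set.ncard_eq_toFinset_card _ hZfin]
    exact hbij.ncard_eq
  · have h1 := vanishingIdeal_le_sup_pow hloc 1
    rw [← heq] at h1
    have h2 : singularIdeal F L ^ (1 + 1) ≤
        chartIdeal (pderiv 1 F) (pderiv 2 F) L ⊔ Ideal.span {pderiv 0 F ^ 2} := by
      rw [one_add_one_eq_two, pow_two, singularIdeal, Ideal.sup_mul, Ideal.mul_sup (Ideal.span _),
        Ideal.span_singleton_mul_span_singleton, ← pow_two]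
      exact sup_le (Ideal.mul_le_left.trans le_sup_left)
        (sup_le_sup_right Ideal.mul_le_right _)
    have h3 := h1.trans (sup_le le_sup_left h2)
      (Ideal.mem_sup_right (Ideal.subset_span rfl) : pderiv 0 F ∈ singularIdeal F L)
    obtain ⟨a, ha, b, hb, hab⟩ := Submodule.mem_sup.1 h3
    obtain ⟨s, rfl⟩ := Ideal.mem_span_singleton'.1 hb
    exact ⟨s, by rwa [← eq_sub_of_add_eq hab]⟩
  · obtain ⟨y, hy⟩ := exists_aeval_eq hZfin.toFinset fun q => (q 0)⁻¹
    refine ⟨y, ?_⟩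
    rw [heq]
    intro q hq
    have hq' : q ∈ hZfin.toFinset := hq
    obtain ⟨h1, h2⟩ := mem_zeroLocus_singularIdeal.1 (hZfin.mem_toFinset.1 hq')
    rw [map_sub, map_mul, map_one, hy q hq', aeval_X,
      mul_inv_cancel₀ (h.zero_ne_zero h1 (ne_zero_of_aeval_eq_one h2)), sub_self]

end Singular

section Length

theorem length_quotient_eq_add {M N : Type*} [AddCommGroup M] [Module ℂ M] [AddCommGroup N]
    [Module ℂ N] (f : M →ₗ[ℂ] N) {T : Submodule ℂ N} (hT : T ≤ LinearMap.range f) :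
    Module.length ℂ (N ⧸ T) =
      Module.length ℂ (M ⧸ T.comap f) + Module.length ℂ (N ⧸ LinearMap.range f) := by
  refine Module.length_eq_add_of_exact (Submodule.mapQ (T.comap f) T f le_rfl)
    (Submodule.factor hT) ?_ (Submodule.factor_surjective hT) ?_
  · rw [← LinearMap.ker_eq_bot, Submodule.ker_mapQ, Submodule.mkQ_map_self]
  · intro x
    obtain ⟨x, rfl⟩ := Submodule.Quotient.mk_surjective _ x
    change Submodule.Quotient.mk x = 0 ↔ _
    rw [Submodule.Quotient.mk_eq_zero]
    constructor
    · rintro ⟨y, rfl⟩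
      exact ⟨Submodule.Quotient.mk y, rfl⟩
    · rintro ⟨y, hy⟩
      obtain ⟨y, rfl⟩ := Submodule.Quotient.mk_surjective _ y
      rw [Submodule.mapQ_apply, Submodule.Quotient.eq] at hy
      have := sub_mem (LinearMap.mem_range_self f y) (hT hy)
      rwa [sub_sub_cancel] at this

theorem length_quotient_range_eq {M N : Type*} [AddCommGroup M] [Module ℂ M] [AddCommGroup N]
    [Module ℂ N] (φ : M →ₗ[ℂ] N) (g : N →ₗ[ℂ] N) (hg : Function.Injective g)
    (hgφ : (LinearMap.range φ).map g ≤ LinearMap.range φ)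
    (hfin : Module.length ℂ (N ⧸ LinearMap.range φ) ≠ ⊤) :
    Module.length ℂ (M ⧸ ((LinearMap.range φ).map g).comap φ) =
      Module.length ℂ (N ⧸ LinearMap.range g) := by
  have h1 := length_quotient_eq_add φ hgφ
  have h2 := length_quotient_eq_add g (LinearMap.map_le_range (p := LinearMap.range φ))
  rw [Submodule.comap_map_eq_of_injective hg] at h2
  rw [h1, add_comm] at h2
  exact WithTop.add_left_cancel hfin h2

/-- If `p = e * p` with `e = s * p` idempotent and `a` is a unit modulo `p`, then the power series
`p + a t` is a unit multiple of `e + (1 - e) t`. -/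
theorem exists_isUnit_mul_eq {W : Type*} [CommRing W] {p s a b z e : W}
    (he : s * p = e) (hpe : p * e = p) (hee : e * e = e)
    (hab : 1 - a * b = z * p) :
    ∃ U : PowerSeries W, IsUnit U ∧ PowerSeries.C p + PowerSeries.C a * PowerSeries.X =
      U * (PowerSeries.C e + PowerSeries.C (1 - e) * PowerSeries.X) := by
  refine ⟨PowerSeries.C (p + (1 - e) * a) + PowerSeries.C (e * a) * PowerSeries.X, ?_, ?_⟩
  · rw [PowerSeries.isUnit_iff_constantCoeff]
    simp only [map_add, map_mul, PowerSeries.constantCoeff_C, PowerSeries.constantCoeff_X, mul_zero,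
      add_zero]
    refine IsUnit.of_mul_eq_one (s * e + (1 - e) * b) ?_
    linear_combination e * he + (1 - a * s + a * b) * hee - (b - z) * hpe - (1 - e) * hab
  · have h1 := congrArg (PowerSeries.C (R := W)) hpe
    have h2 := congrArg (PowerSeries.C (R := W)) hee
    simp only [map_add, map_mul, map_sub, map_one] at h1 h2 ⊢
    linear_combination (PowerSeries.X - 1) * h1 +
      PowerSeries.C a * (1 - 2 * PowerSeries.X + PowerSeries.X ^ 2) * h2

variable {W : Type*} [CommRing W] [Algebra ℂ W]

theorem length_quotient_range_X_pow (m : ℕ) :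
    Module.length ℂ (PowerSeries W ⧸
      LinearMap.range (LinearMap.mulLeft ℂ (PowerSeries.X ^ m : PowerSeries W))) =
      m * Module.length ℂ W := by
  let f : PowerSeries W →ₗ[ℂ] (Fin m → W) :=
    LinearMap.pi fun i => (PowerSeries.coeff (R := W) i.1).restrictScalars ℂ
  have hf (i : Fin m) (v : PowerSeries W) : f v i = PowerSeries.coeff i.1 v := rfl
  have hsurj : Function.Surjective f := fun z => by
    refine ⟨PowerSeries.mk fun i => if h : i < m then z ⟨i, h⟩ else 0, funext fun i => ?_⟩
    rw [hf, PowerSeries.coeff_mk, dif_pos i.2]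
  have hker : LinearMap.ker f =
      LinearMap.range (LinearMap.mulLeft ℂ (PowerSeries.X ^ m : PowerSeries W)) := by
    ext v
    rw [LinearMap.mem_ker, funext_iff]
    constructor
    · intro h
      obtain ⟨u, rfl⟩ := PowerSeries.X_pow_dvd_iff.2 fun i hi => h ⟨i, hi⟩
      exact ⟨u, rfl⟩
    · rintro ⟨u, rfl⟩ i
      exact PowerSeries.X_pow_dvd_iff.1 (Dvd.intro u rfl) i i.2
  rw [← hker, (f.quotKerEquivOfSurjective hsurj).length_eq, Module.length_pi]
  simp

theorem length_quotient_range_mulLeft {p s a b z : W} (hs : p = s * p ^ 2)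
    (hab : 1 - a * b = z * p) :
    Function.Injective (LinearMap.mulLeft ℂ (PowerSeries.C p + PowerSeries.C a * PowerSeries.X)) ∧
    Module.length ℂ (PowerSeries W ⧸ LinearMap.range (LinearMap.mulLeft ℂ
      (PowerSeries.C p + PowerSeries.C a * PowerSeries.X))) =
      Module.length ℂ (W ⧸ Ideal.span {p}) := by
  obtain ⟨e, he⟩ : ∃ e, s * p = e := ⟨_, rfl⟩
  have hpe : p * e = p := by rw [← he]; linear_combination -hs
  have hee : e * e = e := by rw [← he]; linear_combination -s * hs
  obtain ⟨U, hU, hUE⟩ := exists_isUnit_mul_eq he hpe hee hab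
  have hee' : (PowerSeries.C e * PowerSeries.C e : PowerSeries W) = PowerSeries.C e := by
    rw [← map_mul, hee]
  rw [hUE]
  constructor
  · rw [injective_iff_map_eq_zero]
    intro v hv
    rw [LinearMap.mulLeft_apply, mul_assoc, hU.mul_right_eq_zero, map_sub, map_one] at hv
    have h1 : PowerSeries.C e * v = 0 := by
      linear_combination PowerSeries.C e * hv + (PowerSeries.X - 1) * v * hee'
    have h2 : (PowerSeries.X : PowerSeries W) * v = 0 := by
      linear_combination hv + (PowerSeries.X - 1) * h1
    exact PowerSeries.X_mul_inj.1 (h2.trans (mul_zero _).symm)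
  · let f : PowerSeries W →ₗ[ℂ] W ⧸ Ideal.span {p} :=
      ((Ideal.Quotient.mkₐ ℂ (Ideal.span {p})).toLinearMap).comp
        ((PowerSeries.coeff (R := W) 0).restrictScalars ℂ)
    have hf (v : PowerSeries W) :
        f v = Ideal.Quotient.mk (Ideal.span {p}) (PowerSeries.constantCoeff v) := by
      simp [f]
    have hsurj : Function.Surjective f := fun w => by
      obtain ⟨w, rfl⟩ := Ideal.Quotient.mk_surjective w
      exact ⟨PowerSeries.C w, by rw [hf, PowerSeries.constantCoeff_C]⟩
    have hker : LinearMap.ker f = LinearMap.range (LinearMap.mulLeft ℂ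
        (U * (PowerSeries.C e + PowerSeries.C (1 - e) * PowerSeries.X))) := by
      ext v
      rw [LinearMap.mem_ker, hf, Ideal.Quotient.eq_zero_iff_mem, Ideal.mem_span_singleton]
      constructor
      · rintro ⟨r, hr⟩
        obtain ⟨v', hv'⟩ := PowerSeries.X_dvd_iff.2
          (by simp :
            PowerSeries.constantCoeff (v - PowerSeries.C (PowerSeries.constantCoeff v)) = 0)
        obtain ⟨U', hU'⟩ := hU.exists_right_inv
        refine ⟨U' * (PowerSeries.C e * v + PowerSeries.C (1 - e) * v'), ?_⟩
        have h0 : (PowerSeries.C (1 - e) * PowerSeries.C (PowerSeries.constantCoeff v) :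
            PowerSeries W) = 0 := by
          rw [← map_mul, hr, sub_mul, one_mul, ← mul_assoc, mul_comm e, hpe, sub_self, map_zero]
        rw [map_sub, map_one] at h0
        rw [LinearMap.mulLeft_apply, map_sub, map_one]
        linear_combination (PowerSeries.C e + (1 - PowerSeries.C e) * PowerSeries.X) *
          (PowerSeries.C e * v + (1 - PowerSeries.C e) * v') * hU' - (1 - PowerSeries.C e) * hv' -
          h0 + (v - v' - PowerSeries.X * v + PowerSeries.X * v') * hee'
      · rintro ⟨w, rfl⟩
        rw [LinearMap.mulLeft_apply, ← hUE]
        simp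
    rw [← hker, (f.quotKerEquivOfSurjective hsurj).length_eq]

end Length

section ChartExpansion

variable {P Q L D B : R₃} {m : ℕ}

/-- The expansion of a power series along the lines through the origin and the points of the
scheme `P = Q = 0`, in the chart `{L = 1}`. -/
noncomputable def chartExpansion (P Q L : R₃) :
    MvPowerSeries (Fin 3) ℂ →ₐ[ℂ] PowerSeries (R₃ ⧸ chartIdeal P Q L) :=
  (PowerSeries.mapAlgHom (Ideal.Quotient.mkₐ ℂ (chartIdeal P Q L))).comp formExpansion

theorem coeff_chartExpansion (n : ℕ) (F : MvPowerSeries (Fin 3) ℂ) :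
    PowerSeries.coeff n (chartExpansion P Q L F) =
      Ideal.Quotient.mk (chartIdeal P Q L) (form n F) := by
  rw [chartExpansion, AlgHom.comp_apply, PowerSeries.mapAlgHom_apply, PowerSeries.coeff_map,
    coeff_formExpansion]
  rfl

theorem chartExpansion_of_isHomogeneous (hD : D.IsHomogeneous m) :
    chartExpansion P Q L D.toMvPowerSeries =
      PowerSeries.C (Ideal.Quotient.mk (chartIdeal P Q L) D) * PowerSeries.X ^ m := by
  rw [chartExpansion, AlgHom.comp_apply, formExpansion_of_isHomogeneous hD,
    PowerSeries.mapAlgHom_apply, map_mul, map_pow, PowerSeries.map_C, PowerSeries.map_X]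
  rfl

instance smulCommClass_powerSeries {W : Type*} [CommRing W] [Algebra ℂ W] :
    SMulCommClass ℂ (PowerSeries W) (PowerSeries W) :=
  Algebra.to_smulCommClass

namespace IsRegularTriple

theorem chartExpansion_eq_zero_iff (h : IsRegularTriple P Q L m) {F : MvPowerSeries (Fin 3) ℂ} :
    chartExpansion P Q L F = 0 ↔ F ∈ Ideal.span {P.toMvPowerSeries, Q.toMvPowerSeries} := by
  constructor
  · intro hF
    refine Ideal.mem_span_pair.2 (mem_span_of_form_mem h.hP h.hQ fun n => ?_)
    refine mem_span_of_mem_chartIdeal h.hP h.hQ h.hL h.hreg (isHomogeneous_form n F) ?_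
    rw [← Ideal.Quotient.eq_zero_iff_mem, ← coeff_chartExpansion, hF, map_zero]
  · intro hF
    obtain ⟨a, b, rfl⟩ := Ideal.mem_span_pair.1 hF
    have hP : Ideal.Quotient.mk (chartIdeal P Q L) P = 0 :=
      Ideal.Quotient.eq_zero_iff_mem.2 (Ideal.subset_span (by simp))
    have hQ : Ideal.Quotient.mk (chartIdeal P Q L) Q = 0 :=
      Ideal.Quotient.eq_zero_iff_mem.2 (Ideal.subset_span (by simp))
    rw [map_add, map_mul, map_mul, chartExpansion_of_isHomogeneous h.hP,
      chartExpansion_of_isHomogeneous h.hQ, hP, hQ]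
    simp

theorem X_pow_mul_mem_range (h : IsRegularTriple P Q L m)
    (v : PowerSeries (R₃ ⧸ chartIdeal P Q L)) :
    PowerSeries.X ^ (m + m) * v ∈ LinearMap.range (chartExpansion P Q L).toLinearMap := by
  have h1 (n : ℕ) : ∃ G : R₃, G.IsHomogeneous n ∧ Ideal.Quotient.mk (chartIdeal P Q L) G =
      PowerSeries.coeff n (PowerSeries.X ^ (m + m) * v) := by
    by_cases hn : m + m ≤ n
    · rw [← mem_formImage, h.formImage_eq_top hn]
      trivial
    · refine ⟨0, isHomogeneous_zero _ _ _, ?_⟩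
      rw [map_zero, PowerSeries.coeff_X_pow_mul', if_neg hn]
  choose G hG hGv using h1
  obtain ⟨F, hF⟩ := exists_form_eq G hG
  refine ⟨F, ?_⟩
  ext n
  rw [AlgHom.toLinearMap_apply, coeff_chartExpansion, hF, hGv]

theorem length_chart (h : IsRegularTriple P Q L m) :
    Module.length ℂ (R₃ ⧸ chartIdeal P Q L) = (m ^ 2 : ℕ) := by
  have := h.finite
  rw [Module.length_eq_finrank, h.finrank]

theorem length_quotient_range_chartExpansion_ne_top (h : IsRegularTriple P Q L m) :
    Module.length ℂ (PowerSeries (R₃ ⧸ chartIdeal P Q L) ⧸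
      LinearMap.range (chartExpansion P Q L).toLinearMap) ≠ ⊤ := by
  have hle : LinearMap.range (LinearMap.mulLeft ℂ
      (PowerSeries.X ^ (m + m) : PowerSeries (R₃ ⧸ chartIdeal P Q L))) ≤
      LinearMap.range (chartExpansion P Q L).toLinearMap := by
    rintro _ ⟨v, rfl⟩
    exact h.X_pow_mul_mem_range v
  refine ne_top_of_le_ne_top ?_
    (Module.length_le_of_surjective (Submodule.factor hle) (Submodule.factor_surjective hle))
  rw [length_quotient_range_X_pow, h.length_chart]
  exact_mod_cast ENat.natCast_ne_top ((m + m) * m ^ 2)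

theorem comap_map_range_chartExpansion (h : IsRegularTriple P Q L m)
    (G : MvPowerSeries (Fin 3) ℂ) :
    ((LinearMap.range (chartExpansion P Q L).toLinearMap).map
      (LinearMap.mulLeft ℂ (chartExpansion P Q L G))).comap (chartExpansion P Q L).toLinearMap =
    (Ideal.span {G, P.toMvPowerSeries, Q.toMvPowerSeries}).restrictScalars ℂ := by
  ext F
  rw [Submodule.restrictScalars_mem, Ideal.mem_span_insert]
  constructor
  · rintro ⟨_, ⟨E, rfl⟩, hE⟩
    refine ⟨E, F - E * G, h.chartExpansion_eq_zero_iff.1 ?_, by ring⟩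
    rw [LinearMap.mulLeft_apply, AlgHom.toLinearMap_apply, AlgHom.toLinearMap_apply] at hE
    rw [map_sub, map_mul, ← hE]
    ring
  · rintro ⟨E, z, hz, rfl⟩
    refine ⟨_, ⟨E, rfl⟩, ?_⟩
    rw [LinearMap.mulLeft_apply, AlgHom.toLinearMap_apply, AlgHom.toLinearMap_apply, map_add,
      map_mul, h.chartExpansion_eq_zero_iff.2 hz, add_zero, mul_comm]

theorem finrank_quotient_span (h : IsRegularTriple P Q L m) (hD : D.IsHomogeneous m)
    (hB : B.IsHomogeneous (m + 1)) {s y : R₃} (hs : D - s * D ^ 2 ∈ chartIdeal P Q L)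
    (hy : 1 - B * y ∈ chartIdeal P Q L ⊔ Ideal.span {D}) :
    Module.finrank ℂ (MvPowerSeries (Fin 3) ℂ ⧸
      Ideal.span {(D + B).toMvPowerSeries, P.toMvPowerSeries, Q.toMvPowerSeries}) =
    m ^ 3 + Module.finrank ℂ (R₃ ⧸ chartIdeal P Q L ⊔ Ideal.span {D}) := by
  set π := Ideal.Quotient.mk (chartIdeal P Q L)
  have hs' : π D = π s * π D ^ 2 := by
    rwa [← sub_eq_zero, ← map_pow, ← map_mul, ← map_sub, Ideal.Quotient.eq_zero_iff_mem]
  obtain ⟨z, hz⟩ : ∃ z, 1 - π B * π y = z * π D := by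
    obtain ⟨u, hu, v, hv, huv⟩ := Submodule.mem_sup.1 hy
    obtain ⟨z, rfl⟩ := Ideal.mem_span_singleton'.1 hv
    refine ⟨π z, ?_⟩
    rw [← map_mul, ← map_mul, ← map_one π, ← map_sub, ← huv, map_add,
      Ideal.Quotient.eq_zero_iff_mem.2 hu, zero_add]
  obtain ⟨hinj, hlen⟩ := length_quotient_range_mulLeft hs' hz
  set H : PowerSeries (R₃ ⧸ chartIdeal P Q L) :=
    PowerSeries.C (π D) + PowerSeries.C (π B) * PowerSeries.X with hH
  have hG : chartExpansion P Q L (D + B).toMvPowerSeries = PowerSeries.X ^ m * H := by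
    rw [MvPolynomial.coe_add, map_add, chartExpansion_of_isHomogeneous hD,
      chartExpansion_of_isHomogeneous hB, hH]
    ring
  have hmul : LinearMap.mulLeft ℂ (PowerSeries.X ^ m * H) =
      (LinearMap.mulLeft ℂ (PowerSeries.X ^ m)).comp (LinearMap.mulLeft ℂ H) :=
    LinearMap.mulLeft_mul ℂ _ _ _
  have hXinj : Function.Injective
      (LinearMap.mulLeft ℂ (PowerSeries.X ^ m : PowerSeries (R₃ ⧸ chartIdeal P Q L))) := by
    intro u v huv
    ext n
    have := congrArg (PowerSeries.coeff (n + m)) huv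
    rwa [LinearMap.mulLeft_apply, LinearMap.mulLeft_apply, PowerSeries.coeff_X_pow_mul,
      PowerSeries.coeff_X_pow_mul] at this
  have h1 := length_quotient_range_eq (chartExpansion P Q L).toLinearMap
    (LinearMap.mulLeft ℂ (chartExpansion P Q L (D + B).toMvPowerSeries))
    (by rw [hG, hmul]; exact hXinj.comp hinj)
    (by
      rintro _ ⟨_, ⟨F, rfl⟩, rfl⟩
      exact ⟨(D + B).toMvPowerSeries * F, map_mul (chartExpansion P Q L) _ _⟩)
    h.length_quotient_range_chartExpansion_ne_top
  rw [h.comap_map_range_chartExpansion, hG, hmul,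
    (Submodule.Quotient.restrictScalarsEquiv ℂ _).length_eq] at h1
  have h2 := length_quotient_eq_add
    (LinearMap.mulLeft ℂ (PowerSeries.X ^ m : PowerSeries (R₃ ⧸ chartIdeal P Q L)))
    (LinearMap.range_comp_le_range (LinearMap.mulLeft ℂ H) _)
  have hcomap : (LinearMap.range ((LinearMap.mulLeft ℂ (PowerSeries.X ^ m)).comp
      (LinearMap.mulLeft ℂ H))).comap (LinearMap.mulLeft ℂ (PowerSeries.X ^ m)) =
      LinearMap.range (LinearMap.mulLeft ℂ H) := by
    rw [LinearMap.range_comp, Submodule.comap_map_eq_of_injective hXinj]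
  have hquot : Module.length ℂ ((R₃ ⧸ chartIdeal P Q L) ⧸ Ideal.span {π D}) =
      Module.finrank ℂ (R₃ ⧸ chartIdeal P Q L ⊔ Ideal.span {D}) := by
    have := h.finite
    have hmap : Ideal.span {π D} =
        (Ideal.span {D}).map (Ideal.Quotient.mkₐ ℂ (chartIdeal P Q L)) := by
      rw [Ideal.map_span, Set.image_singleton]
      rfl
    rw [hmap, ← (DoubleQuot.quotQuotEquivQuotSupₐ ℂ (chartIdeal P Q L)
      (Ideal.span {D})).toLinearEquiv.finrank_eq, Module.length_eq_finrank]
  rw [hcomap, hlen, length_quotient_range_X_pow, h.length_chart, hquot] at h2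
  rw [h2] at h1
  have h3 := congrArg ENat.toNat h1
  rw [Module.length_eq_rank, Cardinal.toNat_toENat] at h3
  rw [Module.finrank, h3, ← Nat.cast_mul, ← Nat.cast_add, ENat.toNat_natCast]
  ring

end IsRegularTriple

end ChartExpansion

theorem eval_eq_aeval (q : Fin 3 → ℂ) (G : R₃) : eval q G = aeval q G := by
  rw [← coe_aeval_eq_eval, RingHom.coe_coe]

theorem finite_zeroLocus (I : Ideal R₃) [Module.Finite ℂ (R₃ ⧸ I)] : (zeroLocus ℂ I).Finite := by
  let f (q : zeroLocus ℂ I) : (R₃ ⧸ I) →ₐ[ℂ] ℂ := Ideal.Quotient.liftₐ I (aeval q.1) q.2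
  have hf : Function.Injective f := fun p q hpq => by
    ext i
    have := DFunLike.congr_fun hpq (Ideal.Quotient.mk I (X i))
    change aeval p.1 (X i) = aeval q.1 (X i) at this
    rwa [aeval_X, aeval_X] at this
  exact Set.finite_coe_iff.1 (Finite.of_injective f hf)

theorem mem_zeroLocus_chartIdeal {P Q L : R₃} {q : Fin 3 → ℂ} (hP : aeval q P = 0)
    (hQ : aeval q Q = 0) (hL : aeval q L = 1) : q ∈ zeroLocus ℂ (chartIdeal P Q L) := by
  have h : chartIdeal P Q L ≤ vanishingIdeal ℂ {q} := by
    refine Ideal.span_le.2 ?_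
    rintro v (rfl | rfl | rfl) <;>
      simp only [SetLike.mem_coe, mem_vanishingIdeal_singleton_iff, hP, hQ, map_sub, map_one, hL,
        sub_self]
  intro v hv
  exact (mem_vanishingIdeal_singleton_iff q v).1 (h hv)

namespace IsNodal

variable {F : R₃} {m : ℕ}

open Filter Topology

theorem eventually_ne_zero_of_mem_zeroLocus (h : IsNodal F m) {l c : ℂ}
    (hR : IsRegularTriple (pderiv 1 F) (pderiv 2 F) (X 0 + C l * X 2) m) (hc : c ≠ 0) :
    ∀ᶠ t : ℂ in 𝓝 0,
      ∀ w ∈ zeroLocus ℂ (chartIdeal (pderiv 1 F) (pderiv 2 F) (X 0 + C l * X 2)),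
        aeval w (pderiv 0 F) + c * w 0 ^ (m + 1) * t = 0 → t = 0 := by
  have := hR.finite
  rw [eventually_all_finite (finite_zeroLocus _)]
  intro w hw
  by_cases h0 : aeval w (pderiv 0 F) = 0
  · have hw1 : aeval w (pderiv 1 F) = 0 := hw _ (Ideal.subset_span (by simp))
    have hw2 : aeval w (pderiv 2 F) = 0 := hw _ (Ideal.subset_span (by simp))
    have hw3 : aeval w (X 0 + C l * X 2 - 1 : R₃) = 0 := hw _ (Ideal.subset_span (by simp))
    rw [map_sub, map_one, sub_eq_zero] at hw3
    have hw0 := h.zero_ne_zero (Fin.forall_fin_succ.2 ⟨h0, Fin.forall_fin_two.2 ⟨hw1, hw2⟩⟩)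
      (ne_zero_of_aeval_eq_one hw3)
    refine Eventually.of_forall fun t ht => ?_
    rw [h0, zero_add] at ht
    exact (mul_eq_zero.1 ht).resolve_left (mul_ne_zero hc (pow_ne_zero _ hw0))
  · have hcont : ContinuousAt (fun t => aeval w (pderiv 0 F) + c * w 0 ^ (m + 1) * t) 0 :=
      (continuous_const.add (continuous_const.mul continuous_id)).continuousAt
    filter_upwards [hcont.eventually_ne (by rwa [mul_zero, add_zero])] with t ht ht'
    exact absurd ht' ht

theorem eventually_eq_zero (h : IsNodal F m) {c : ℂ} (hc : c ≠ 0) :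
    ∀ᶠ p : Fin 3 → ℂ in 𝓝 0, aeval p (pderiv 0 F) + c * p 0 ^ (m + 1) = 0 →
      aeval p (pderiv 1 F) = 0 → aeval p (pderiv 2 F) = 0 → p = 0 := by
  obtain ⟨l, hR⟩ := h.exists_isRegularTriple
  have hLp (p : Fin 3 → ℂ) : aeval p (X 0 + C l * X 2 : R₃) = p 0 + l * p 2 := by simp
  have hcont : Tendsto (fun p : Fin 3 → ℂ => p 0 + l * p 2) (𝓝 0) (𝓝 0) := by
    have : Continuous (fun p : Fin 3 → ℂ => p 0 + l * p 2) := by fun_prop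
    simpa using this.tendsto 0
  filter_upwards [hcont.eventually (h.eventually_ne_zero_of_mem_zeroLocus hR hc)] with p hp h0 h1 h2
  by_contra hp0
  obtain ⟨t, ht⟩ : ∃ t, p 0 + l * p 2 = t := ⟨_, rfl⟩
  rw [ht] at hp
  have ht0 : t ≠ 0 := by
    rintro rfl
    exact hp0 (hR.eq_zero_of_eval_eq_zero ((eval_eq_aeval _ _).trans h1)
      ((eval_eq_aeval _ _).trans h2) ((eval_eq_aeval _ _).trans ((hLp p).trans ht)))
  refine ht0 (hp (t⁻¹ • p) (mem_zeroLocus_chartIdeal ?_ ?_ ?_) ?_)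
  · rw [aeval_smul_of_isHomogeneous hR.hP, h1, mul_zero]
  · rw [aeval_smul_of_isHomogeneous hR.hQ, h2, mul_zero]
  · rw [aeval_smul_of_isHomogeneous hR.hL, hLp, ht, pow_one, inv_mul_cancel₀ ht0]
  · rw [aeval_smul_of_isHomogeneous (h.isHomogeneous_pderiv 0), Pi.smul_apply, smul_eq_mul, mul_pow,
      pow_succ t⁻¹]
    linear_combination t⁻¹ ^ m * h0 + c * t⁻¹ ^ m * p 0 ^ (m + 1) * inv_mul_cancel₀ ht0

theorem pderiv_zero_add_pow :
    pderiv 0 (F + X 0 ^ (m + 2)) = pderiv 0 F + C ((m + 2 : ℕ) : ℂ) * X 0 ^ (m + 1) := by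
  rw [map_add, pderiv_pow, pderiv_X_self, mul_one, map_natCast]
  rfl

theorem pderiv_add_pow {i : Fin 3} (hi : i ≠ 0) : pderiv i (F + X 0 ^ (m + 2)) = pderiv i F := by
  rw [map_add, pderiv_pow, pderiv_X_of_ne hi.symm, mul_zero, add_zero]

theorem hasIsolatedCriticalPointAtOrigin (h : IsNodal F m) :
    HasIsolatedCriticalPointAtOrigin (F + X 0 ^ (m + 2)) := by
  have h0 (i : Fin 3) : aeval (0 : Fin 3 → ℂ) (pderiv i F) = 0 := by
    have := aeval_smul_of_isHomogeneous (h.isHomogeneous_pderiv i) 0 0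
    rwa [zero_pow (by have := h.two_le; omega), zero_mul, smul_zero] at this
  constructor
  · intro i
    by_cases hi : i = 0
    · subst hi
      rw [pderiv_zero_add_pow, map_add, eval_eq_aeval, h0]
      simp
    · rw [pderiv_add_pow hi, eval_eq_aeval, h0]
  · obtain ⟨ε, hε, hb⟩ := Metric.eventually_nhds_iff.1
      (h.eventually_eq_zero (c := ((m + 2 : ℕ) : ℂ)) (Nat.cast_ne_zero.2 (by omega)))
    refine ⟨ε, hε, fun p hp hcrit => hb (by rwa [dist_zero_right]) ?_ ?_ ?_⟩
    · have := hcrit 0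
      rw [pderiv_zero_add_pow, eval_eq_aeval] at this
      simpa only [map_add, map_mul, map_pow, aeval_X, aeval_C, Algebra.algebraMap_self,
        RingHom.id_apply] using this
    · have := hcrit 1
      rwa [pderiv_add_pow (by decide), eval_eq_aeval] at this
    · have := hcrit 2
      rwa [pderiv_add_pow (by decide), eval_eq_aeval] at this

theorem milnorNumber_eq (h : IsNodal F m) (hfin : (affineSingularPoints F).Finite) :
    milnorNumber (F + X 0 ^ (m + 2)) = m ^ 3 + (affineSingularPoints F).ncard := by
  obtain ⟨l, hR⟩ := h.exists_isRegularTriple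
  obtain ⟨hcard, ⟨s, hs⟩, y, hy⟩ := h.singularIdeal_spec hR hfin
  have hc : ((m + 2 : ℕ) : ℂ) ≠ 0 := Nat.cast_ne_zero.2 (by omega)
  have hrange : Set.range (fun i : Fin 3 => (pderiv i (F + X 0 ^ (m + 2))).toMvPowerSeries) =
      {(pderiv 0 F + C ((m + 2 : ℕ) : ℂ) * X 0 ^ (m + 1)).toMvPowerSeries,
        (pderiv 1 F).toMvPowerSeries, (pderiv 2 F).toMvPowerSeries} := by
    rw [← pderiv_zero_add_pow, ← pderiv_add_pow (F := F) (m := m) (i := 1) (by decide),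
      ← pderiv_add_pow (F := F) (m := m) (i := 2) (by decide)]
    ext v
    simp [Fin.exists_fin_succ, eq_comm]
  have hB : (C ((m + 2 : ℕ) : ℂ) * X 0 ^ (m + 1) : R₃).IsHomogeneous (m + 1) := by
    simpa using (isHomogeneous_C (Fin 3) ((m + 2 : ℕ) : ℂ)).mul ((isHomogeneous_X ℂ 0).pow (m + 1))
  have hy' : 1 - C ((m + 2 : ℕ) : ℂ) * X 0 ^ (m + 1) * (C ((m + 2 : ℕ) : ℂ)⁻¹ * y ^ (m + 1)) ∈
      singularIdeal F (X 0 + C l * X 2) := by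
    have h1 : (C ((m + 2 : ℕ) : ℂ) * C ((m + 2 : ℕ) : ℂ)⁻¹ : R₃) = 1 := by
      rw [← C_mul, mul_inv_cancel₀ hc, C_1]
    obtain ⟨v, hv⟩ := sub_dvd_pow_sub_pow 1 (X 0 * y) (m + 1)
    rw [one_pow, mul_pow] at hv
    have h2 : 1 - C ((m + 2 : ℕ) : ℂ) * X 0 ^ (m + 1) * (C ((m + 2 : ℕ) : ℂ)⁻¹ * y ^ (m + 1)) =
        (1 - X 0 * y) * v := by
      linear_combination hv - X 0 ^ (m + 1) * y ^ (m + 1) * h1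
    rw [h2]
    exact Ideal.mul_mem_right _ _ hy
  rw [milnorNumber, hrange, hR.finrank_quotient_span (h.isHomogeneous_pderiv 0) hB hs hy', ← hcard]
  rfl

end IsNodal

end NodalMilnor

/-- Shift formula for the Milnor number: if `f_d` is an irreducible convenient homogeneous
polynomial of degree `d ≥ 3` whose projective curve `C = {f_d = 0}` has exactly `k` singular
points, with `k ≤ (d−1)(d−2)/2`, each an ordinary node and all lying in the affine chart
`{x ≠ 0}`, then `f = f_d + x^{d+1}` has an isolated critical point at the origin with Milnor
number `μ(f) = (d−1)³ + k`. -/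
theorem milnor_number_of_nodal_isolation
    (d k : ℕ) (hd : 3 ≤ d) (hk : k ≤ (d - 1) * (d - 2) / 2)
    (fd : MvPolynomial (Fin 3) ℂ)
    (hhom : fd.IsHomogeneous d) (hirr : Irreducible fd)
    (hconv : ∀ i : Fin 3, coeff (Finsupp.single i d) fd ≠ 0)
    -- all singular points of `C` lie in the affine chart `{x ≠ 0}`:
    (haff : ∀ p : Fin 3 → ℂ, p ≠ 0 → eval p fd = 0 →
      (∀ i, eval p (pderiv i fd) = 0) → p 0 ≠ 0)
    -- `C` has exactly `k` singular points:
    (hcard : {q : Fin 2 → ℂ | eval q (dehom0 fd) = 0 ∧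
        ∀ j, eval q (pderiv j (dehom0 fd)) = 0}.Finite ∧
      {q : Fin 2 → ℂ | eval q (dehom0 fd) = 0 ∧
        ∀ j, eval q (pderiv j (dehom0 fd)) = 0}.ncard = k)
    -- each singular point of `C` is an ordinary node:
    (hnode : ∀ q : Fin 2 → ℂ, eval q (dehom0 fd) = 0 →
      (∀ j, eval q (pderiv j (dehom0 fd)) = 0) →
      Matrix.det !![eval q (pderiv 0 (pderiv 0 (dehom0 fd))),
          eval q (pderiv 1 (pderiv 0 (dehom0 fd)));
          eval q (pderiv 0 (pderiv 1 (dehom0 fd))),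
          eval q (pderiv 1 (pderiv 1 (dehom0 fd)))] ≠ 0)
    (f : MvPolynomial (Fin 3) ℂ) (hf : f = fd + X 0 ^ (d + 1)) :
    HasIsolatedCriticalPointAtOrigin f ∧ milnorNumber f = (d - 1) ^ 3 + k := by
  obtain ⟨m, rfl⟩ : ∃ m, d = m + 1 := ⟨d - 1, by omega⟩
  have h : NodalMilnor.IsNodal fd m := ⟨by omega, hhom, hconv, haff, hnode⟩
  subst hf
  refine ⟨h.hasIsolatedCriticalPointAtOrigin, ?_⟩
  rw [Nat.add_sub_cancel, ← hcard.2]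
  exact h.milnorNumber_eq hcard.1
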